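/- Under the standing assumptions on a and q, for every bounded set K ⊂ [0,∞) there exist δ ∈ (0, 1/4) and constants C > 0 and b₀ > 0 such that for all c ∈ K, all real b ≥ b₀, and every Schwartz function u : ℝ → ℂ whose Fourier transform 𝓕u is supported in (b − 2δb, b + 2δb) or supported in (−b − 2δb, −b + 2δb), setting λ = −c + i·b, one has (2b − C)·‖u‖ ≤ N_A(c)·‖T(λ)u‖ (an inequality in [0,∞]). -/

import Mathlib

open MeasureTheory Filter
open scoped ENNReal

/-- The quadratic operator family `T(λ)u = -u'' + q·u + 2λ·a·u + λ²·u`. -/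
noncomputable def Tq (a q : ℝ → ℝ) (lam : ℂ) (u : ℝ → ℂ) : ℝ → ℂ :=
  fun x => -deriv (deriv u) x + (q x : ℂ) * u x + 2 * lam * (a x : ℂ) * u x + lam ^ 2 * u x

/-- Standing assumptions on the damping `a` and the potential `q`. -/
structure Standing (a q : ℝ → ℝ) : Prop where
  smooth_a : ContDiff ℝ (⊤ : ℕ∞) a
  smooth_q : ContDiff ℝ (⊤ : ℕ∞) q
  nonneg_a : ∀ x, 0 ≤ a x
  nonneg_q : ∀ x, 0 ≤ q x
  unbounded_a : Tendsto a (cocompact ℝ) atTop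
  deriv_a : ∀ n : ℕ, 1 ≤ n → ∃ C : ℝ, 0 < C ∧ ∀ x : ℝ,
      |iteratedDeriv n a x| ≤ C * (1 + a x) * (1 + x ^ 2) ^ (-(n : ℝ) / 2)
  deriv_q : ∀ n : ℕ, 1 ≤ n → ∃ C : ℝ, 0 < C ∧ ∀ x : ℝ,
      |iteratedDeriv n q x| ≤ C * (1 + q x) * (1 + x ^ 2) ^ (-(n : ℝ) / 2)
  q_le_a : ∃ K₀ : ℝ, 0 < K₀ ∧ ∃ x₀ : ℝ, 0 < x₀ ∧ ∀ x : ℝ, x₀ < |x| → q x ≤ K₀ * a x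

/-- The norm of the resolvent `(A - c)⁻¹` of the generalised Airy operator
`A = -d/dx + a`, as the supremum of `‖u‖ / ‖-u' + a·u - c·u‖` over nonzero
Schwartz functions, valued in `[0,∞]`. -/
noncomputable def NA (a : ℝ → ℝ) (c : ℝ) : ℝ≥0∞ :=
  ⨆ (u : SchwartzMap ℝ ℂ) (_ : u ≠ 0),
    eLpNorm (⇑u) 2 volume /
      eLpNorm (fun x => -deriv (⇑u) x + (a x : ℂ) * u x - (c : ℂ) * u x) 2 volume

/-- Fourier transform `𝓕u(ξ) = (2π)^(-1/2) ∫ e^(-iξx) u(x) dx`. -/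
noncomputable def FT (u : ℝ → ℂ) : ℝ → ℂ :=
  fun ξ => (↑(Real.sqrt (2 * Real.pi)))⁻¹ * ∫ x : ℝ, Complex.exp (-(Complex.I * (ξ : ℂ) * (x : ℂ))) * u x

/-- Inverse Fourier transform `𝓕⁻¹u(x) = (2π)^(-1/2) ∫ e^(ixξ) u(ξ) dξ`. -/
noncomputable def FTinv (u : ℝ → ℂ) : ℝ → ℂ :=
  fun x => (↑(Real.sqrt (2 * Real.pi)))⁻¹ * ∫ ξ : ℝ, Complex.exp (Complex.I * (x : ℂ) * (ξ : ℂ)) * u ξ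

open scoped ContDiff

/-! ### Temperate growth -/

theorem poly_growth (a : ℝ → ℝ) (ha : Differentiable ℝ a) (h0 : ∀ x, 0 ≤ a x) (C : ℝ)
    (hd : ∀ x, |deriv a x| ≤ C * (1 + a x) * (1 + x ^ 2) ^ (-(1 : ℝ) / 2)) :
    ∃ k : ℕ, ∃ M : ℝ, 0 ≤ M ∧ ∀ x, 1 + a x ≤ M * (1 + |x|) ^ k := by
  obtain ⟨k, hk⟩ := exists_nat_ge C
  have hpos : ∀ x, 0 < 1 + a x := fun x => by linarith [h0 x]
  have hsq : ∀ x : ℝ, (1 + x ^ 2) ^ (-(1 : ℝ) / 2) = (√(1 + x ^ 2))⁻¹ := by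
    intro x
    rw [Real.sqrt_eq_rpow, ← Real.rpow_neg (by positivity)]
    norm_num
  have hder : ∀ x, HasDerivAt (fun y => Real.log (1 + a y)) (deriv a x / (1 + a x)) x := by
    intro x
    exact ((ha x).hasDerivAt.const_add 1).log (hpos x).ne'
  have hbd : ∀ x, |deriv a x / (1 + a x)| ≤ C * (√(1 + x ^ 2))⁻¹ := by
    intro x
    rw [abs_div, abs_of_pos (hpos x), div_le_iff₀ (hpos x), ← hsq]
    linarith [hd x]
  have hanti : Antitone (fun y => Real.log (1 + a y) - C * Real.arsinh y) := by
    apply antitone_of_hasDerivAt_nonpos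
      (f' := fun x => deriv a x / (1 + a x) - C * (√(1 + x ^ 2))⁻¹)
    · intro x
      exact (hder x).sub ((Real.hasDerivAt_arsinh x).const_mul C)
    · intro x
      have := (abs_le.1 (hbd x)).2
      simp only [Pi.zero_apply]
      linarith
  have hmono : Monotone (fun y => Real.log (1 + a y) + C * Real.arsinh y) := by
    apply monotone_of_hasDerivAt_nonneg
      (f' := fun x => deriv a x / (1 + a x) + C * (√(1 + x ^ 2))⁻¹)
    · intro x
      exact (hder x).add ((Real.hasDerivAt_arsinh x).const_mul C)
    · intro x
      have := (abs_le.1 (hbd x)).1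
      simp only [Pi.zero_apply]
      linarith
  have hlog : ∀ x, Real.log (1 + a x) ≤ Real.log (1 + a 0) + C * Real.arsinh |x| := by
    intro x
    rcases le_total 0 x with hx | hx
    · have := hanti hx
      simp only [Real.arsinh_zero] at this
      rw [abs_of_nonneg hx]; linarith
    · have := hmono hx
      simp only [Real.arsinh_zero] at this
      rw [abs_of_nonpos hx, Real.arsinh_neg]; linarith
  refine ⟨k, (1 + a 0) * 2 ^ k, by have := hpos 0; positivity, fun x => ?_⟩
  have h1 : Real.arsinh |x| ≥ 0 := Real.arsinh_nonneg_iff.2 (abs_nonneg x)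
  have h2 : Real.log (1 + a x) ≤ Real.log (1 + a 0) + k * Real.arsinh |x| := by
    have := mul_le_mul_of_nonneg_right hk h1
    linarith [hlog x]
  calc 1 + a x = Real.exp (Real.log (1 + a x)) := (Real.exp_log (hpos x)).symm
    _ ≤ Real.exp (Real.log (1 + a 0) + k * Real.arsinh |x|) := Real.exp_le_exp.2 h2
    _ = (1 + a 0) * (|x| + √(1 + |x| ^ 2)) ^ k := by
        rw [Real.exp_add, Real.exp_log (hpos 0), Real.exp_nat_mul, Real.exp_arsinh]
    _ ≤ (1 + a 0) * (2 * (1 + |x|)) ^ k := by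
        have : √(1 + |x| ^ 2) ≤ 1 + |x| := by
          apply Real.sqrt_le_iff.2
          constructor
          · positivity
          · nlinarith [abs_nonneg x]
        have h3 := (hpos 0).le
        gcongr
        linarith
    _ = _ := by rw [mul_pow]; ring

theorem temperate_of_std (a : ℝ → ℝ) (ha : ContDiff ℝ (⊤ : ℕ∞) a) (h0 : ∀ x, 0 ≤ a x)
    (hd : ∀ n : ℕ, 1 ≤ n → ∃ C : ℝ, 0 < C ∧ ∀ x : ℝ,
      |iteratedDeriv n a x| ≤ C * (1 + a x) * (1 + x ^ 2) ^ (-(n : ℝ) / 2)) :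
    a.HasTemperateGrowth := by
  obtain ⟨C, hC, h1⟩ := hd 1 le_rfl
  simp only [iteratedDeriv_one, Nat.cast_one] at h1
  obtain ⟨k, M, hM, hp⟩ := poly_growth a (ha.differentiable (by simp)) h0 C h1
  refine ⟨ha, fun n => ?_⟩
  rcases Nat.eq_zero_or_pos n with rfl | hn
  · refine ⟨k, M, fun x => ?_⟩
    have := hp x
    simp only [norm_iteratedFDeriv_zero, Real.norm_eq_abs, abs_of_nonneg (h0 x)]
    linarith
  · obtain ⟨Cn, hCn, hb⟩ := hd n hn
    refine ⟨k, Cn * M, fun x => ?_⟩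
    rw [norm_iteratedFDeriv_eq_norm_iteratedDeriv, Real.norm_eq_abs, Real.norm_eq_abs]
    have h2 : (1 + x ^ 2) ^ (-(n : ℝ) / 2) ≤ 1 :=
      Real.rpow_le_one_of_one_le_of_nonpos (by nlinarith)
        (by have : (0 : ℝ) ≤ n := n.cast_nonneg
            linarith)
    have h3 : 0 ≤ Cn * (1 + a x) := by have := h0 x; positivity
    calc |iteratedDeriv n a x| ≤ Cn * (1 + a x) * 1 :=
          (hb x).trans (mul_le_mul_of_nonneg_left h2 h3)
      _ ≤ Cn * (M * (1 + |x|) ^ k) := by rw [mul_one]; gcongr; exact hp x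
      _ = _ := by ring

theorem temperate_exp (b : ℝ) :
    (fun x : ℝ => Complex.exp (Complex.I * b * x)).HasTemperateGrowth := by
  have hd : ContDiff ℝ ∞ (fun x : ℝ => Complex.exp (Complex.I * b * x)) := by
    exact (contDiff_const.mul Complex.ofRealCLM.contDiff).cexp
  refine ⟨hd, fun n => ⟨0, |b| ^ n, fun x => ?_⟩⟩
  have hn : ∀ n : ℕ, iteratedDeriv n (fun x : ℝ => Complex.exp (Complex.I * b * x))
      = fun x : ℝ => (Complex.I * b) ^ n * Complex.exp (Complex.I * b * x) := by
    intro n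
    induction n with
    | zero => simp
    | succ n ih =>
      rw [iteratedDeriv_succ, ih]
      funext x
      have : HasDerivAt (fun x : ℝ => Complex.exp (Complex.I * b * x))
          (Complex.exp (Complex.I * b * x) * (Complex.I * b * 1)) x :=
        ((Complex.ofRealCLM.hasDerivAt (x := x)).const_mul (Complex.I * (b:ℂ))).cexp
      rw [(this.const_mul _).deriv]
      ring
  rw [norm_iteratedFDeriv_eq_norm_iteratedDeriv, hn]
  have : Complex.I * b * x = ((b * x : ℝ) : ℂ) * Complex.I := by push_cast; ring
  simp only [norm_mul, norm_pow, this, Complex.norm_exp_ofReal_mul_I]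
  simp

theorem temperate_deriv {a : ℝ → ℝ} (ha : a.HasTemperateGrowth) :
    (deriv a).HasTemperateGrowth := by
  refine ⟨(contDiff_infty_iff_deriv.1 ha.1).2, fun n => ?_⟩
  obtain ⟨k, C, h⟩ := ha.2 (n + 1)
  refine ⟨k, C, fun x => ?_⟩
  have := h x
  rwa [norm_iteratedFDeriv_eq_norm_iteratedDeriv, iteratedDeriv_succ',
    ← norm_iteratedFDeriv_eq_norm_iteratedDeriv] at this

/-! ### Solving `h' + p h = v` in Schwartz space -/

theorem temperate_ofReal {p : ℝ → ℝ} (hp : p.HasTemperateGrowth) :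
    (fun x => (p x : ℂ)).HasTemperateGrowth :=
  Function.HasTemperateGrowth.comp Complex.ofRealCLM.hasTemperateGrowth hp

/-- Bootstrapping: a rapidly decaying solution is a Schwartz function. -/
theorem schwartz_bootstrap (p : ℝ → ℂ) (hp : p.HasTemperateGrowth) (v : SchwartzMap ℝ ℂ)
    (h : ℝ → ℂ) (hd : ∀ x, HasDerivAt h (v x - p x * h x) x)
    (hdec : ∀ k : ℕ, ∃ C, ∀ x, (1 + ‖x‖) ^ k * ‖h x‖ ≤ C) :
    ∃ H : SchwartzMap ℝ ℂ, ∀ x, H x = h x := by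
  have hder : deriv h = fun x => v x - p x * h x := funext fun x => (hd x).deriv
  have hsm : ∀ n : ℕ, ContDiff ℝ n h := by
    intro n
    induction n with
    | zero =>
      exact contDiff_zero.2 (continuous_iff_continuousAt.2 fun x => (hd x).continuousAt)
    | succ n ih =>
      have : ContDiff ℝ ((n : WithTop ℕ∞) + 1) h := by
        rw [contDiff_succ_iff_deriv]
        refine ⟨fun x => (hd x).differentiableAt, by simp, ?_⟩
        rw [hder]
        exact (v.smooth n).sub ((hp.1.of_le (by exact_mod_cast le_top)).mul ih)
      exact_mod_cast this
  have hsm' : ContDiff ℝ ∞ h := contDiff_infty.2 hsm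
  have key : ∀ n : ℕ, ∀ m ≤ n, ∀ k : ℕ, ∃ C, ∀ x,
      (1 + ‖x‖) ^ k * ‖iteratedFDeriv ℝ m h x‖ ≤ C := by
    intro n
    induction n with
    | zero =>
      intro m hm k
      obtain rfl : m = 0 := by omega
      simpa using hdec k
    | succ n ih =>
      intro m hm k
      rcases Nat.lt_or_ge m (n + 1) with hlt | hge
      · exact ih m (by omega) k
      obtain rfl : m = n + 1 := by omega
      obtain ⟨j, Cp, hCp, hpb⟩ := hp.norm_iteratedFDeriv_le_uniform n
      choose! Ch hCh using fun m (hm : m ≤ n) => ih m hm (k + j)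
      have hv := fun x => SchwartzMap.one_add_le_sup_seminorm_apply (𝕜 := ℝ)
        (m := (k, n)) (le_refl k) (le_refl n) v x
      set Cv := 2 ^ (k, n).1 * ((Finset.Iic (k, n)).sup
        fun m => SchwartzMap.seminorm ℝ m.1 m.2) v with hCv
      refine ⟨Cv + ∑ i ∈ Finset.range (n + 1), (n.choose i : ℝ) * (Cp * Ch (n - i)), fun x => ?_⟩
      have e1 : ‖iteratedFDeriv ℝ (n + 1) h x‖
          = ‖iteratedFDeriv ℝ n (fun x => v x - p x * h x) x‖ := by
        rw [norm_iteratedFDeriv_eq_norm_iteratedDeriv, iteratedDeriv_succ', hder,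
          ← norm_iteratedFDeriv_eq_norm_iteratedDeriv]
      have e2 : iteratedFDeriv ℝ n (fun x => v x - p x * h x) x
          = iteratedFDeriv ℝ n v x - iteratedFDeriv ℝ n (fun x => p x * h x) x := by
        have hph : ContDiff ℝ n (fun x => p x * h x) :=
          (hp.1.of_le (by exact_mod_cast le_top)).mul (hsm n)
        have := iteratedFDeriv_sub_apply (𝕜 := ℝ) (x := x)
          (v.smooth n).contDiffAt hph.contDiffAt
        exact this
      have e3 := norm_iteratedFDeriv_mul_le (n := n) (hp.1) hsm' x (by exact_mod_cast le_top)
      have hx : (0 : ℝ) ≤ (1 + ‖x‖) ^ k := by positivity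
      rw [e1, e2]
      calc (1 + ‖x‖) ^ k * ‖iteratedFDeriv ℝ n v x - iteratedFDeriv ℝ n (fun x => p x * h x) x‖
          ≤ (1 + ‖x‖) ^ k * (‖iteratedFDeriv ℝ n v x‖ +
              ∑ i ∈ Finset.range (n + 1), (n.choose i : ℝ) * ‖iteratedFDeriv ℝ i p x‖ *
                ‖iteratedFDeriv ℝ (n - i) h x‖) := by
            refine mul_le_mul_of_nonneg_left ((norm_sub_le _ _).trans ?_) hx
            gcongr
        _ = (1 + ‖x‖) ^ k * ‖iteratedFDeriv ℝ n v x‖ + ∑ i ∈ Finset.range (n + 1),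
              (1 + ‖x‖) ^ k * ((n.choose i : ℝ) * ‖iteratedFDeriv ℝ i p x‖ *
                ‖iteratedFDeriv ℝ (n - i) h x‖) := by
            rw [mul_add, Finset.mul_sum]
        _ ≤ _ := by
            refine add_le_add (hv x) (Finset.sum_le_sum fun i hi => ?_)
            have hi' : i ≤ n := by simpa [Nat.lt_succ_iff] using hi
            have h1 := hpb i hi' x
            have h2 := hCh (n - i) (by omega) x
            calc (1 + ‖x‖) ^ k * ((n.choose i : ℝ) * ‖iteratedFDeriv ℝ i p x‖ *
                ‖iteratedFDeriv ℝ (n - i) h x‖)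
                ≤ (1 + ‖x‖) ^ k * ((n.choose i : ℝ) * (Cp * (1 + ‖x‖) ^ j) *
                ‖iteratedFDeriv ℝ (n - i) h x‖) := by gcongr
              _ = (n.choose i : ℝ) * (Cp * ((1 + ‖x‖) ^ (k + j) *
                ‖iteratedFDeriv ℝ (n - i) h x‖)) := by rw [pow_add]; ring
              _ ≤ _ := by gcongr
  refine ⟨⟨h, hsm', fun k n => ?_⟩, fun x => rfl⟩
  obtain ⟨C, hC⟩ := key n n le_rfl k
  refine ⟨C, fun x => le_trans ?_ (hC x)⟩
  gcongr
  linarith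

theorem exists_sol (p : ℝ → ℝ) (hp : p.HasTemperateGrowth) (β : ℝ) (hβ0 : 0 ≤ β)
    (hβ : ∀ x, 1 ≤ p x + β / (1 + x ^ 2)) (v : SchwartzMap ℝ ℂ) :
    ∃ h : SchwartzMap ℝ ℂ, ∀ x, deriv h x + (p x : ℂ) * h x = v x := by
  have hpc : Continuous p := hp.1.continuous
  set P : ℝ → ℝ := fun x => ∫ s in (0:ℝ)..x, p s with hPdef
  have hP : ∀ x, HasDerivAt P (p x) x := fun x =>
    (hpc.integral_hasStrictDerivAt 0 x).hasDerivAt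
  have hPc : Continuous P := continuous_iff_continuousAt.2 fun x => (hP x).continuousAt
  have hmono : Monotone (fun x => P x + β * Real.arctan x - x) := by
    apply monotone_of_hasDerivAt_nonneg (f' := fun x => p x + β * (1 / (1 + x ^ 2)) - 1)
    · intro x
      exact ((hP x).add ((Real.hasDerivAt_arctan x).const_mul β)).sub (hasDerivAt_id x)
    · intro x
      have := hβ x
      simp only [Pi.zero_apply]
      rw [mul_one_div]; linarith
  set B := Real.exp (β * Real.pi) with hB
  have hker : ∀ x t, t ≤ x → Real.exp (P t) ≤ Real.exp (P x) * (B * Real.exp (t - x)) := by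
    intro x t htx
    rw [hB, ← Real.exp_add, ← Real.exp_add]
    apply Real.exp_le_exp.2
    have h1 := hmono htx
    simp only at h1
    have h2 := Real.arctan_lt_pi_div_two x
    have h3 := Real.neg_pi_div_two_lt_arctan t
    have h4 : β * (Real.arctan x - Real.arctan t) ≤ β * Real.pi :=
      mul_le_mul_of_nonneg_left (by linarith) hβ0
    linarith
  -- weighted bound
  have hw : ∀ k : ℕ, ∃ C, 0 ≤ C ∧ ∀ x t, t ≤ x →
      (1 + ‖x‖) ^ k * (Real.exp (P t) * ‖v t‖) ≤
        Real.exp (P x) * (C * Real.exp (1 / 2 * t) * Real.exp (-(1 / 2 * x))) := by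
    intro k
    have hv := fun x => SchwartzMap.one_add_le_sup_seminorm_apply (𝕜 := ℝ)
        (m := (k, 0)) (le_refl k) (le_refl 0) v x
    set Cv := 2 ^ (k, 0).1 * ((Finset.Iic (k, 0)).sup
        fun m => SchwartzMap.seminorm ℝ m.1 m.2) v with hCv
    have hCv0 : 0 ≤ Cv := le_trans (by positivity) (hv 0)
    set Q : ℝ := 2 ^ k * k.factorial * Real.exp (1 / 2) with hQ
    have hQ0 : 0 ≤ Q := by positivity
    have hpow : ∀ s : ℝ, 0 ≤ s → (1 + s) ^ k ≤ Q * Real.exp (s / 2) := by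
      intro s hs
      have := Real.pow_div_factorial_le_exp ((1 + s) / 2) (by positivity) k
      rw [div_le_iff₀ (by positivity), div_pow, div_le_iff₀ (by positivity), add_div,
        Real.exp_add] at this
      linarith
    refine ⟨B * (Q * Cv), by positivity, fun x t htx => ?_⟩
    have hpeetre : 1 + ‖x‖ ≤ (1 + ‖t‖) * (1 + (x - t)) := by
      have h1 : ‖x‖ ≤ ‖t‖ + (x - t) := by
        have := norm_add_le t (x - t)
        rw [add_sub_cancel, Real.norm_of_nonneg (sub_nonneg.2 htx)] at this
        exact this
      nlinarith [norm_nonneg t, sub_nonneg.2 htx]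
    have hvt := hv t
    rw [norm_iteratedFDeriv_zero] at hvt
    have e1 : Real.exp ((x - t) / 2) * Real.exp (t - x)
        = Real.exp (1 / 2 * t) * Real.exp (-(1 / 2 * x)) := by
      rw [← Real.exp_add, ← Real.exp_add]; congr 1; ring
    have hk := hker x t htx
    have hpw := hpow (x - t) (sub_nonneg.2 htx)
    calc (1 + ‖x‖) ^ k * (Real.exp (P t) * ‖v t‖)
        ≤ ((1 + ‖t‖) * (1 + (x - t))) ^ k * ((Real.exp (P x) * (B * Real.exp (t - x))) * ‖v t‖) := by
          gcongr
      _ = ((1 + ‖t‖) ^ k * ‖v t‖) * ((1 + (x - t)) ^ k) *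
            (Real.exp (P x) * (B * Real.exp (t - x))) := by rw [mul_pow]; ring
      _ ≤ Cv * (Q * Real.exp ((x - t) / 2)) * (Real.exp (P x) * (B * Real.exp (t - x))) := by
          have : 0 ≤ (1 + (x - t)) ^ k := by
            have := sub_nonneg.2 htx
            positivity
          gcongr
      _ = Real.exp (P x) * (B * (Q * Cv) * (Real.exp ((x - t) / 2) * Real.exp (t - x))) := by ring
      _ = _ := by rw [e1]; ring
  set F : ℝ → ℂ := fun t => (Real.exp (P t) : ℂ) * v t with hF
  have hFn : ∀ t, ‖F t‖ = Real.exp (P t) * ‖v t‖ := by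
    intro t
    rw [hF]; simp only [norm_mul, Complex.norm_real, Real.norm_eq_abs, Real.abs_exp]
  have hFc : Continuous F :=
    (Complex.continuous_ofReal.comp (Real.continuous_exp.comp hPc)).mul v.continuous
  have hgi : ∀ C x : ℝ, IntegrableOn (fun t => Real.exp (P x) *
      (C * Real.exp (1 / 2 * t) * Real.exp (-(1 / 2 * x)))) (Set.Iic x) volume := by
    intro C x
    have := (integrableOn_exp_mul_Iic (a := 1 / 2) (by norm_num) x)
    exact (((this.const_mul C).mul_const _).const_mul _)
  have hFi : ∀ x, IntegrableOn F (Set.Iic x) volume := by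
    intro x
    obtain ⟨C, hC0, hC⟩ := hw 0
    refine (hgi C x).mono' hFc.aestronglyMeasurable ?_
    refine (ae_restrict_iff' measurableSet_Iic).2 (Eventually.of_forall fun t ht => ?_)
    have := hC x t ht
    rw [pow_zero, one_mul] at this
    rw [hFn]; exact this
  set G : ℝ → ℂ := fun x => ∫ t in Set.Iic x, F t with hG
  have hGd : ∀ x, HasDerivAt G (F x) x := by
    intro x
    have e : G = fun y => (∫ t in Set.Iic 0, F t) + ∫ t in (0:ℝ)..y, F t := by
      funext y
      rw [← intervalIntegral.integral_Iic_sub_Iic (hFi 0) (hFi y)]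
      simp [hG]
    rw [e]
    exact ((hFc.integral_hasStrictDerivAt 0 x).hasDerivAt).const_add _
  set h : ℝ → ℂ := fun x => (Real.exp (-P x) : ℂ) * G x with hh
  have hhd : ∀ x, HasDerivAt h (v x - (p x : ℂ) * h x) x := by
    intro x
    have h1 : HasDerivAt (fun x => ((Real.exp (-P x) : ℝ) : ℂ))
        ((Real.exp (-P x) * (-p x) : ℝ) : ℂ) x := ((hP x).neg.exp).ofReal_comp
    have h2 := h1.mul (hGd x)
    refine h2.congr_deriv ?_
    have e : ((Real.exp (-P x) : ℝ) : ℂ) * ((Real.exp (P x) : ℝ) : ℂ) = 1 := by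
      rw [← Complex.ofReal_mul, ← Real.exp_add]; simp
    simp only [hh, hF]
    rw [← mul_assoc, e, Complex.ofReal_mul, Complex.ofReal_neg]
    ring
  have hdec : ∀ k : ℕ, ∃ C, ∀ x, (1 + ‖x‖) ^ k * ‖h x‖ ≤ C := by
    intro k
    obtain ⟨C, hC0, hC⟩ := hw k
    refine ⟨C * 2, fun x => ?_⟩
    have h1 : (1 + ‖x‖) ^ k * ‖G x‖ ≤ Real.exp (P x) * (C * 2) := by
      calc (1 + ‖x‖) ^ k * ‖G x‖ ≤ (1 + ‖x‖) ^ k * ∫ t in Set.Iic x, ‖F t‖ := by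
            gcongr; exact norm_integral_le_integral_norm _
        _ = ∫ t in Set.Iic x, (1 + ‖x‖) ^ k * ‖F t‖ := by rw [integral_const_mul]
        _ ≤ ∫ t in Set.Iic x, Real.exp (P x) *
              (C * Real.exp (1 / 2 * t) * Real.exp (-(1 / 2 * x))) := by
            refine setIntegral_mono_on ((hFi x).norm.const_mul _) (hgi C x) measurableSet_Iic ?_
            intro t ht
            rw [hFn]; exact hC x t ht
        _ = Real.exp (P x) * (C * (Real.exp (1 / 2 * x) / (1 / 2)) * Real.exp (-(1 / 2 * x))) := by
            rw [integral_const_mul, integral_mul_const, integral_const_mul,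
              integral_exp_mul_Iic (by norm_num)]
        _ = _ := by
            have : Real.exp (1 / 2 * x) * Real.exp (-(1 / 2 * x)) = 1 := by
              rw [← Real.exp_add]; simp
            linear_combination (Real.exp (P x) * C * 2) * this
    have e : Real.exp (-P x) * Real.exp (P x) = 1 := by rw [← Real.exp_add]; simp
    have e2 : ‖h x‖ = Real.exp (-P x) * ‖G x‖ := by
      simp only [hh, norm_mul, Complex.norm_real, Real.norm_eq_abs, Real.abs_exp]
    calc (1 + ‖x‖) ^ k * ‖h x‖ = Real.exp (-P x) * ((1 + ‖x‖) ^ k * ‖G x‖) := by rw [e2]; ring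
      _ ≤ Real.exp (-P x) * (Real.exp (P x) * (C * 2)) := by gcongr
      _ = C * 2 := by rw [← mul_assoc, e, one_mul]
  obtain ⟨H, hH⟩ := schwartz_bootstrap (fun x => (p x : ℂ)) (temperate_ofReal hp) v h hhd hdec
  refine ⟨H, fun x => ?_⟩
  have : (⇑H) = h := funext hH
  rw [this, (hhd x).deriv]
  ring

/-- Version with both signs. -/
theorem exists_sol_sign (p : ℝ → ℝ) (hp : p.HasTemperateGrowth) (β : ℝ) (hβ0 : 0 ≤ β)
    (hβ : ∀ x, 1 ≤ p x + β / (1 + x ^ 2)) (τ : ℝ) (hτ : τ = 1 ∨ τ = -1) (v : SchwartzMap ℝ ℂ) :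
    ∃ h : SchwartzMap ℝ ℂ, ∀ x, (τ : ℂ) * deriv h x + (p x : ℂ) * h x = v x := by
  rcases hτ with rfl | rfl
  · obtain ⟨h, hh⟩ := exists_sol p hp β hβ0 hβ v
    exact ⟨h, fun x => by simpa using hh x⟩
  · let R := SchwartzMap.compCLMOfContinuousLinearEquiv (F := ℂ) ℂ (ContinuousLinearEquiv.neg ℝ (M := ℝ))
    have hneg : (fun x : ℝ => -x).HasTemperateGrowth := Function.HasTemperateGrowth.id'.neg
    obtain ⟨h, hh⟩ := exists_sol (fun x => p (-x)) (hp.comp hneg) β hβ0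
      (fun x => by have := hβ (-x); simpa using this) (R v)
    refine ⟨R h, fun x => ?_⟩
    have e : (⇑(R h)) = fun x => h (-x) := rfl
    have e2 : R v (-x) = v x := by
      change v (- -x) = v x
      rw [neg_neg]
    have := hh (-x)
    rw [e2, neg_neg] at this
    rw [e, deriv_comp_neg]
    push_cast
    rw [← this]; ring

/-! ### The `L²` framework -/

/-- The embedding of Schwartz functions into `L²`. -/
noncomputable def L2 : SchwartzMap ℝ ℂ →L[ℂ] Lp ℂ 2 (volume : Measure ℝ) :=
  SchwartzMap.toLpCLM ℂ ℂ 2 volume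

/-- The derivative on Schwartz functions. -/
noncomputable def DD : SchwartzMap ℝ ℂ →L[ℂ] SchwartzMap ℝ ℂ := SchwartzMap.derivCLM ℂ ℂ

/-- Multiplication by a real function on Schwartz functions. -/
noncomputable def MM (a : ℝ → ℝ) : SchwartzMap ℝ ℂ →L[ℂ] SchwartzMap ℝ ℂ :=
  SchwartzMap.smulLeftCLM ℂ (fun x => (a x : ℂ))

theorem DD_apply (f : SchwartzMap ℝ ℂ) (x : ℝ) : DD f x = deriv f x := rfl

theorem MM_apply {a : ℝ → ℝ} (ha : a.HasTemperateGrowth) (f : SchwartzMap ℝ ℂ) (x : ℝ) :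
    MM a f x = (a x : ℂ) * f x := by
  rw [MM, SchwartzMap.smulLeftCLM_apply_apply (temperate_ofReal ha), smul_eq_mul]

theorem eLpNorm_eq_L2 (f : SchwartzMap ℝ ℂ) :
    eLpNorm (⇑f) 2 volume = ENNReal.ofReal ‖L2 f‖ := by
  have : ‖L2 f‖ = (eLpNorm (⇑f) 2 volume).toReal := SchwartzMap.norm_toLp
  rw [this, ENNReal.ofReal_toReal (f.eLpNorm_lt_top 2 volume).ne]

theorem L2_mono {f g : SchwartzMap ℝ ℂ} (h : ∀ x, ‖f x‖ ≤ ‖g x‖) : ‖L2 f‖ ≤ ‖L2 g‖ := by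
  have h1 : ‖L2 f‖ = (eLpNorm (⇑f) 2 volume).toReal := SchwartzMap.norm_toLp
  have h2 : ‖L2 g‖ = (eLpNorm (⇑g) 2 volume).toReal := SchwartzMap.norm_toLp
  rw [h1, h2]
  exact ENNReal.toReal_mono (g.eLpNorm_lt_top 2 volume).ne (eLpNorm_mono h)

theorem L2_inner (f g : SchwartzMap ℝ ℂ) :
    inner ℂ (L2 f) (L2 g) = ∫ x, (starRingEnd ℂ) (f x) * g x := by
  have := SchwartzMap.inner_toL2_toL2_eq f g volume
  refine this.trans ?_
  congr 1
  funext x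
  rw [RCLike.inner_apply, mul_comm]

theorem L2_normSq (f : SchwartzMap ℝ ℂ) : ‖L2 f‖ ^ 2 = ∫ x, ‖f x‖ ^ 2 := by
  have h1 := L2_inner f f
  rw [inner_self_eq_norm_sq_to_K] at h1
  have h2 : ∀ x, (starRingEnd ℂ) (f x) * f x = ((‖f x‖ ^ 2 : ℝ) : ℂ) := by
    intro x
    rw [mul_comm, Complex.mul_conj, Complex.normSq_eq_norm_sq]
  simp only [h2] at h1
  rw [integral_complex_ofReal] at h1
  refine Complex.ofReal_injective ?_
  rw [Complex.ofReal_pow]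
  exact h1

theorem L2_ibp (f g : SchwartzMap ℝ ℂ) :
    inner ℂ (L2 (DD f)) (L2 g) = - inner ℂ (L2 f) (L2 (DD g)) := by
  rw [L2_inner, L2_inner]
  have := SchwartzMap.integral_bilinear_deriv_right_eq_neg_left f g
    ((ContinuousLinearMap.mul ℝ ℂ).comp (Complex.conjCLE : ℂ →L[ℝ] ℂ))
  simp only [ContinuousLinearMap.comp_apply, ContinuousLinearMap.mul_apply',
    ContinuousLinearEquiv.coe_coe, Complex.conjCLE_apply] at this
  simp only [DD_apply]
  rw [this, neg_neg]

theorem L2_MM_symm {a : ℝ → ℝ} (ha : a.HasTemperateGrowth) (f g : SchwartzMap ℝ ℂ) :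
    inner ℂ (L2 (MM a f)) (L2 g) = inner ℂ (L2 f) (L2 (MM a g)) := by
  rw [L2_inner, L2_inner]
  congr 1
  funext x
  rw [MM_apply ha, MM_apply ha, map_mul, Complex.conj_ofReal]
  ring

theorem DD_MM {a : ℝ → ℝ} (ha : a.HasTemperateGrowth) (f : SchwartzMap ℝ ℂ) :
    DD (MM a f) = MM (deriv a) f + MM a (DD f) := by
  ext x
  rw [add_apply, MM_apply (temperate_deriv ha), MM_apply ha, DD_apply, DD_apply]
  have e : (⇑(MM a f)) = fun x => (a x : ℂ) * f x := funext (MM_apply ha f)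
  have hd : HasDerivAt a (deriv a x) x := (ha.1.differentiable (by simp) x).hasDerivAt
  rw [e]
  exact (hd.ofReal_comp.mul (f.hasDerivAt x)).deriv

/-- Crude a priori estimate. -/
theorem energy (p : ℝ → ℝ) (β : ℝ) (hβ0 : 0 ≤ β)
    (hβ : ∀ x, 1 ≤ p x + β / (1 + x ^ 2)) (τ : ℝ) (hτ : τ = 1 ∨ τ = -1) (h g : SchwartzMap ℝ ℂ)
    (hg : ∀ x, (τ : ℂ) * deriv h x + (p x : ℂ) * h x = g x) :
    ‖L2 h‖ ≤ Real.exp (Real.pi * β) * ‖L2 g‖ := by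
  have hτ2 : τ * τ = 1 := by rcases hτ with rfl | rfl <;> norm_num
  have hτa : |τ| = 1 := by rcases hτ with rfl | rfl <;> norm_num
  set W : ℝ → ℝ := fun x => Real.exp (-(2 * τ * β) * Real.arctan x) with hW
  set E := Real.exp (Real.pi * β) with hE
  have hE0 : 0 < E := Real.exp_pos _
  have hWpos : ∀ x, 0 < W x := fun x => Real.exp_pos _
  have hWc : Continuous W := by
    exact Real.continuous_exp.comp (continuous_const.mul Real.continuous_arctan)
  have habs : ∀ x, |-(2 * τ * β) * Real.arctan x| ≤ Real.pi * β := by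
    intro x
    have h1 : |Real.arctan x| ≤ Real.pi / 2 :=
      abs_le.2 ⟨(Real.neg_pi_div_two_lt_arctan x).le, (Real.arctan_lt_pi_div_two x).le⟩
    rw [abs_mul, abs_neg, abs_mul, abs_mul, hτa, abs_of_nonneg hβ0]
    simp only [Nat.abs_ofNat, mul_one]
    nlinarith [abs_nonneg (Real.arctan x)]
  have hWle : ∀ x, W x ≤ E := fun x => Real.exp_le_exp.2 ((le_abs_self _).trans (habs x))
  have hWge : ∀ x, E⁻¹ ≤ W x := by
    intro x
    rw [hE, ← Real.exp_neg]
    exact Real.exp_le_exp.2 (neg_le_of_abs_le (habs x))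
  have hWd : ∀ x, HasDerivAt W (W x * (-(2 * τ * β) * (1 / (1 + x ^ 2)))) x := fun x =>
    ((Real.hasDerivAt_arctan x).const_mul _).exp
  have hsqInt : ∀ f : SchwartzMap ℝ ℂ, Integrable (fun x => ‖f x‖ ^ 2) volume := fun f =>
    (f.memLp 2 volume).integrable_norm_pow (by norm_num)
  have hWint : ∀ f : SchwartzMap ℝ ℂ, Integrable (fun x => W x * ‖f x‖ ^ 2) volume := by
    intro f
    refine (hsqInt f).bdd_mul (c := E) hWc.aestronglyMeasurable (Eventually.of_forall fun x => ?_)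
    rw [Real.norm_of_nonneg (hWpos x).le]; exact hWle x
  set F' : ℝ → ℝ := fun x => W x * (-(2 * τ * β) * (1 / (1 + x ^ 2))) * ‖h x‖ ^ 2
    + W x * (2 * inner ℝ (h x) (deriv h x)) with hF'
  have hFd : ∀ x, HasDerivAt (fun x => W x * ‖h x‖ ^ 2) (F' x) x := fun x =>
    (hWd x).mul ((h.hasDerivAt x).norm_sq)
  have hip : Integrable (fun x => inner ℝ (h x) (deriv h x)) volume := by
    have hc : Continuous (fun x => inner ℝ (h x) (deriv h x)) :=
      h.continuous.inner (DD h).continuous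
    refine ((hsqInt h).add (hsqInt (DD h))).mono' hc.aestronglyMeasurable
      (Eventually.of_forall fun x => ?_)
    have := norm_inner_le_norm (𝕜 := ℝ) (h x) (deriv h x)
    simp only [Pi.add_apply, DD_apply]
    nlinarith [sq_nonneg (‖h x‖ - ‖deriv h x‖), sq_nonneg (‖h x‖), sq_nonneg ‖deriv h x‖]
  have hF'i : Integrable F' volume := by
    refine Integrable.add ?_ ?_
    · have hc : Continuous (fun x : ℝ => W x * (-(2 * τ * β) * (1 / (1 + x ^ 2)))) := by
        refine hWc.mul (continuous_const.mul ?_)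
        exact continuous_const.div (by fun_prop) (fun x => by positivity)
      refine (hsqInt h).bdd_mul (c := E * (2 * β)) hc.aestronglyMeasurable
        (Eventually.of_forall fun x => ?_)
      rw [norm_mul, norm_mul, Real.norm_of_nonneg (hWpos x).le]
      have h1 : ‖-(2 * τ * β)‖ = 2 * β := by
        rw [norm_neg, norm_mul, norm_mul, Real.norm_eq_abs τ, hτa, Real.norm_of_nonneg hβ0]
        norm_num
      have h2 : ‖1 / (1 + x ^ 2)‖ ≤ 1 := by
        rw [Real.norm_of_nonneg (by positivity)]
        rw [div_le_one (by positivity)]; nlinarith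
      rw [h1]
      have := hWle x
      have h3 : 2 * β * ‖1 / (1 + x ^ 2)‖ ≤ 2 * β * 1 :=
        mul_le_mul_of_nonneg_left h2 (by positivity)
      rw [mul_one] at h3
      exact mul_le_mul this h3 (by positivity) hE0.le
    · refine (hip.const_mul 2).bdd_mul (c := E) hWc.aestronglyMeasurable
        (Eventually.of_forall fun x => ?_)
      rw [Real.norm_of_nonneg (hWpos x).le]; exact hWle x
  have hzero : ∫ x, F' x = 0 :=
    integral_eq_zero_of_hasDerivAt_of_integrable hFd hF'i (hWint h)
  have hpt : ∀ x, τ * F' x ≤ W x * ‖g x‖ ^ 2 - W x * ‖h x‖ ^ 2 := by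
    intro x
    have h1 : inner ℝ (h x) (g x) = τ * inner ℝ (h x) (deriv h x) + p x * ‖h x‖ ^ 2 := by
      rw [← hg x]
      have e : (τ : ℂ) * deriv h x + (p x : ℂ) * h x = τ • deriv h x + p x • h x := by
        simp
      rw [e, inner_add_right, inner_smul_right, inner_smul_right, real_inner_self_eq_norm_sq]
    have h2 : inner ℝ (h x) (g x) ≤ ‖h x‖ * ‖g x‖ := real_inner_le_norm _ _
    have h3 : τ * F' x = 2 * W x * (inner ℝ (h x) (g x) - (p x + β / (1 + x ^ 2)) * ‖h x‖ ^ 2) := by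
      rw [h1, hF']
      simp only
      rw [div_eq_mul_one_div β]
      linear_combination (-(2 * β * (1 / (1 + x ^ 2)) * W x * ‖h x‖ ^ 2)) * hτ2
    rw [h3]
    have h4 : ‖h x‖ ^ 2 ≤ (p x + β / (1 + x ^ 2)) * ‖h x‖ ^ 2 := by
      have := mul_le_mul_of_nonneg_right (hβ x) (sq_nonneg ‖h x‖)
      linarith
    have h5 : 2 * (inner ℝ (h x) (g x) - (p x + β / (1 + x ^ 2)) * ‖h x‖ ^ 2)
        ≤ ‖g x‖ ^ 2 - ‖h x‖ ^ 2 := by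
      nlinarith [sq_nonneg (‖h x‖ - ‖g x‖)]
    nlinarith [hWpos x]
  have hI : ∫ x, W x * ‖h x‖ ^ 2 ≤ ∫ x, W x * ‖g x‖ ^ 2 := by
    have := integral_mono (hF'i.const_mul τ) ((hWint g).sub (hWint h)) hpt
    rw [integral_const_mul, hzero, mul_zero] at this
    simp only [Pi.sub_apply] at this
    rw [integral_sub (hWint g) (hWint h)] at this
    linarith
  have h1 : E⁻¹ * ‖L2 h‖ ^ 2 ≤ ∫ x, W x * ‖h x‖ ^ 2 := by
    rw [L2_normSq, ← integral_const_mul]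
    refine integral_mono ((hsqInt h).const_mul _) (hWint h) fun x => ?_
    exact mul_le_mul_of_nonneg_right (hWge x) (sq_nonneg _)
  have h2 : ∫ x, W x * ‖g x‖ ^ 2 ≤ E * ‖L2 g‖ ^ 2 := by
    rw [L2_normSq, ← integral_const_mul]
    refine integral_mono (hWint g) ((hsqInt g).const_mul _) fun x => ?_
    exact mul_le_mul_of_nonneg_right (hWle x) (sq_nonneg _)
  have h3 : E⁻¹ * ‖L2 h‖ ^ 2 ≤ E * ‖L2 g‖ ^ 2 := h1.trans (hI.trans h2)
  have h4 : ‖L2 h‖ ^ 2 ≤ (E * ‖L2 g‖) ^ 2 := by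
    rw [inv_mul_le_iff₀ hE0] at h3
    linarith
  exact le_of_sq_le_sq h4 (by positivity)

open scoped FourierTransform in
theorem fourier_DD (u : SchwartzMap ℝ ℂ) (ξ : ℝ) :
    𝓕 (DD u) ξ = (2 * Real.pi * Complex.I * ξ) * 𝓕 u ξ := by
  have h := Real.fourier_deriv (f := ⇑u) u.integrable (fun x => (u.hasDerivAt x).differentiableAt)
    (DD u).integrable
  have h2 := congrFun h ξ
  rw [smul_eq_mul] at h2
  exact h2

open scoped FourierTransform in
theorem FT_eq_fourier (u : SchwartzMap ℝ ℂ) (ξ : ℝ) :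
    FT u (2 * Real.pi * ξ) = (↑(Real.sqrt (2 * Real.pi)))⁻¹ * 𝓕 u ξ := by
  rw [FT, SchwartzMap.fourier_coe, Real.fourier_eq']
  congr 1
  congr 1
  funext x
  rw [smul_eq_mul]
  congr 2
  simp
  ring

open scoped FourierTransform in
/-- Plancherel estimate for one-sided frequency localisation. -/
theorem plancherel_est (b : ℝ) (hb : 0 ≤ b) (σ : ℝ) (hσ : σ = 1 ∨ σ = -1) (u : SchwartzMap ℝ ℂ)
    (hu : ∀ ξ, FT u ξ ≠ 0 → 0 ≤ σ * ξ) :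
    b * ‖L2 (DD u - (Complex.I * σ * b) • u)‖ ≤ ‖L2 (DD (DD u) + ((b : ℂ) ^ 2) • u)‖ := by
  have hF : ∀ f : SchwartzMap ℝ ℂ, ‖L2 (𝓕 f)‖ = ‖L2 f‖ := fun f =>
    SchwartzMap.norm_fourier_toL2_eq f
  have e1 : b * ‖L2 (DD u - (Complex.I * σ * b) • u)‖
      = ‖L2 ((b : ℂ) • 𝓕 (DD u - (Complex.I * σ * b) • u))‖ := by
    rw [map_smul, norm_smul, hF, Complex.norm_real, Real.norm_of_nonneg hb]
  rw [e1, ← hF (DD (DD u) + _)]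
  apply L2_mono
  intro ξ
  have hadd : 𝓕 (DD (DD u) + ((b : ℂ) ^ 2) • u) = 𝓕 (DD (DD u)) + ((b : ℂ) ^ 2) • 𝓕 u := by
    rw [FourierTransform.fourier_add, FourierTransform.fourier_smul]
  have hsub : 𝓕 (DD u - (Complex.I * σ * b) • u) = 𝓕 (DD u) - (Complex.I * σ * b) • 𝓕 u := by
    rw [sub_eq_add_neg, ← neg_smul, FourierTransform.fourier_add, FourierTransform.fourier_smul,
      neg_smul, ← sub_eq_add_neg]
  rw [hadd, hsub, add_apply, smul_apply, smul_apply, sub_apply, smul_apply, fourier_DD, fourier_DD,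
    fourier_DD]
  by_cases h0 : 𝓕 u ξ = 0
  · simp [h0]
  have hpos : 0 ≤ σ * (2 * Real.pi * ξ) := by
    apply hu
    rw [FT_eq_fourier]
    refine mul_ne_zero (inv_ne_zero ?_) h0
    have : (0 : ℝ) < √(2 * Real.pi) := by positivity
    exact_mod_cast this.ne'
  set η := 2 * Real.pi * ξ with hη
  have hσ2 : (σ : ℂ) * σ = 1 := by
    rcases hσ with rfl | rfl <;> norm_num
  have hσa : |σ| = 1 := by rcases hσ with rfl | rfl <;> norm_num
  have hσr : σ * σ = 1 := by rcases hσ with rfl | rfl <;> norm_num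
  have f1 : (b : ℂ) • (2 * Real.pi * Complex.I * ξ * 𝓕 u ξ - (Complex.I * σ * b) • 𝓕 u ξ)
      = (b : ℂ) * Complex.I * ((η - σ * b : ℝ) : ℂ) * 𝓕 u ξ := by
    simp only [smul_eq_mul, hη]; push_cast; ring
  have f2 : 2 * Real.pi * Complex.I * ξ * (2 * Real.pi * Complex.I * ξ * 𝓕 u ξ)
      + ((b : ℂ) ^ 2) • 𝓕 u ξ = -((η + σ * b : ℝ) : ℂ) * ((η - σ * b : ℝ) : ℂ) * 𝓕 u ξ := by
    simp only [smul_eq_mul, hη]; push_cast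
    linear_combination (4 * Real.pi ^ 2 * ξ ^ 2 * 𝓕 u ξ) * Complex.I_sq
      - (b : ℂ) ^ 2 * 𝓕 u ξ * hσ2
  rw [f1, f2]
  simp only [norm_mul, norm_neg, Complex.norm_real, Complex.norm_I, mul_one]
  have : ‖b‖ ≤ ‖η + σ * b‖ := by
    rw [Real.norm_of_nonneg hb, Real.norm_eq_abs]
    have h1 : |η + σ * b| = |σ * (η + σ * b)| := by rw [abs_mul, hσa, one_mul]
    rw [h1]
    refine le_trans ?_ (le_abs_self _)
    nlinarith
  gcongr

/-! ### The operators `τ D + a - c` and the norm `N_A` -/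

theorem adj_identity {a : ℝ → ℝ} (ha : a.HasTemperateGrowth) (c τ : ℝ) (f w : SchwartzMap ℝ ℂ) :
    inner ℂ (L2 f) (L2 ((τ : ℂ) • DD w + MM a w - (c : ℂ) • w))
      = inner ℂ (L2 (-((τ : ℂ) • DD f) + MM a f - (c : ℂ) • f)) (L2 w) := by
  simp only [map_add, map_sub, map_neg, map_smul, inner_add_left, inner_add_right, inner_sub_left,
    inner_sub_right, inner_smul_left, inner_smul_right, inner_neg_left, Complex.conj_ofReal]
  rw [L2_ibp, L2_MM_symm ha]
  ring

theorem L2_ne_zero {f : SchwartzMap ℝ ℂ} (hf : f ≠ 0) : 0 < ‖L2 f‖ := by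
  rw [norm_pos_iff]
  intro h
  apply hf
  have := SchwartzMap.injective_toLp (E := ℝ) (F := ℂ) 2 volume
  apply this
  have h0 : L2 (0 : SchwartzMap ℝ ℂ) = 0 := map_zero _
  exact h.trans h0.symm

theorem NA_facts (a : ℝ → ℝ) (ha : a.HasTemperateGrowth) (β c : ℝ) (hβ0 : 0 ≤ β)
    (hβ : ∀ x, 1 ≤ (a x - c) + β / (1 + x ^ 2)) :
    ∃ N : ℝ, 0 ≤ N ∧ N ≤ Real.exp (Real.pi * β) ∧ NA a c = ENNReal.ofReal N ∧
      ∀ τ : ℝ, (τ = 1 ∨ τ = -1) → ∀ h : SchwartzMap ℝ ℂ,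
        ‖L2 h‖ ≤ N * ‖L2 ((τ : ℂ) • DD h + MM a h - (c : ℂ) • h)‖ := by
  set M := Real.exp (Real.pi * β) with hM
  have hM0 : 0 < M := Real.exp_pos _
  have happ : ∀ (τ : ℝ) (h : SchwartzMap ℝ ℂ) (x : ℝ),
      ((τ : ℂ) • DD h + MM a h - (c : ℂ) • h) x
        = (τ : ℂ) * deriv h x + ((a x - c : ℝ) : ℂ) * h x := by
    intro τ h x
    rw [sub_apply, add_apply, smul_apply, smul_apply, MM_apply ha, DD_apply]
    simp only [smul_eq_mul]; push_cast; ring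
  have hen : ∀ τ : ℝ, (τ = 1 ∨ τ = -1) → ∀ h : SchwartzMap ℝ ℂ,
        ‖L2 h‖ ≤ M * ‖L2 ((τ : ℂ) • DD h + MM a h - (c : ℂ) • h)‖ := by
    intro τ hτ h
    exact energy (fun x => a x - c) β hβ0 hβ τ hτ h _ (fun x => (happ τ h x).symm)
  have hfun : ∀ h : SchwartzMap ℝ ℂ,
      eLpNorm (fun x => -deriv (⇑h) x + (a x : ℂ) * h x - (c : ℂ) * h x) 2 volume
        = ENNReal.ofReal ‖L2 (((-1 : ℝ) : ℂ) • DD h + MM a h - (c : ℂ) • h)‖ := by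
    intro h
    rw [← eLpNorm_eq_L2]
    congr 1
    funext x
    rw [happ]; push_cast; ring
  have hle : NA a c ≤ ENNReal.ofReal M := by
    refine iSup₂_le fun h hh => ?_
    rw [hfun, eLpNorm_eq_L2]
    refine ENNReal.div_le_of_le_mul ?_
    rw [← ENNReal.ofReal_mul hM0.le]
    exact ENNReal.ofReal_le_ofReal (hen _ (Or.inr rfl) h)
  have hfin : NA a c ≠ ⊤ := (hle.trans_lt ENNReal.ofReal_lt_top).ne
  set N := (NA a c).toReal with hN
  have hN0 : 0 ≤ N := ENNReal.toReal_nonneg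
  have hNeq : NA a c = ENNReal.ofReal N := (ENNReal.ofReal_toReal hfin).symm
  have hminus : ∀ h : SchwartzMap ℝ ℂ,
      ‖L2 h‖ ≤ N * ‖L2 (((-1 : ℝ) : ℂ) • DD h + MM a h - (c : ℂ) • h)‖ := by
    intro h
    by_cases hh : h = 0
    · subst hh
      rw [map_zero, norm_zero]; positivity
    have h1 : eLpNorm (⇑h) 2 volume /
        eLpNorm (fun x => -deriv (⇑h) x + (a x : ℂ) * h x - (c : ℂ) * h x) 2 volume ≤ NA a c :=
      le_iSup₂ (f := fun (u : SchwartzMap ℝ ℂ) (_ : u ≠ 0) => eLpNorm (⇑u) 2 volume /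
        eLpNorm (fun x => -deriv (⇑u) x + (a x : ℂ) * u x - (c : ℂ) * u x) 2 volume) h hh
    rw [hfun, eLpNorm_eq_L2, hNeq] at h1
    have hpos := L2_ne_zero hh
    have hg : 0 < ‖L2 (((-1 : ℝ) : ℂ) • DD h + MM a h - (c : ℂ) • h)‖ := by
      have := hen _ (Or.inr rfl) h
      by_contra hcon
      have h0 := le_antisymm (not_lt.1 hcon) (norm_nonneg _)
      rw [h0, mul_zero] at this
      linarith
    rw [← ENNReal.ofReal_div_of_pos hg, ENNReal.ofReal_le_ofReal_iff hN0, div_le_iff₀ hg] at h1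
    exact h1
  refine ⟨N, hN0, ?_, hNeq, ?_⟩
  · rw [hNeq] at hle
    exact (ENNReal.ofReal_le_ofReal_iff hM0.le).1 hle
  · intro τ hτ h
    rcases hτ with rfl | rfl
    · obtain ⟨w, hw⟩ := exists_sol_sign (fun x => a x - c)
        (ha.sub (Function.HasTemperateGrowth.const c)) β hβ0 hβ (-1) (Or.inr rfl) h
      have hw' : ((-1 : ℝ) : ℂ) • DD w + MM a w - (c : ℂ) • w = h := by
        ext x
        rw [happ]; exact hw x
      have h1 := hminus w
      rw [hw'] at h1
      have h2 := adj_identity ha c (-1) h w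
      rw [hw'] at h2
      have e : (-(((-1 : ℝ) : ℂ) • DD h) + MM a h - (c : ℂ) • h)
          = (((1 : ℝ) : ℂ) • DD h + MM a h - (c : ℂ) • h) := by
        simp
      rw [e] at h2
      set g := (((1 : ℝ) : ℂ) • DD h + MM a h - (c : ℂ) • h) with hg
      have h3 : ‖L2 h‖ ^ 2 ≤ ‖L2 g‖ * ‖L2 w‖ := by
        have := norm_inner_le_norm (𝕜 := ℂ) (L2 g) (L2 w)
        rw [← h2, inner_self_eq_norm_sq_to_K] at this
        simpa using this
      by_cases hz : ‖L2 h‖ = 0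
      · rw [hz]; positivity
      · have hp : 0 < ‖L2 h‖ := lt_of_le_of_ne (norm_nonneg _) (Ne.symm hz)
        have h4 : ‖L2 h‖ * ‖L2 h‖ ≤ (N * ‖L2 g‖) * ‖L2 h‖ := by
          nlinarith [norm_nonneg (L2 g)]
        exact le_of_mul_le_mul_right h4 hp
    · exact hminus h

/-! ### Commutator estimates -/

theorem re_DD_MM {a : ℝ → ℝ} (ha : a.HasTemperateGrowth) (v : SchwartzMap ℝ ℂ) :
    |2 * (inner ℂ (L2 (DD v)) (L2 (MM a v))).re| ≤ ‖L2 v‖ * ‖L2 (MM (deriv a) v)‖ := by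
  have h1 : inner ℂ (L2 (DD v)) (L2 (MM a v)) = - inner ℂ (L2 v) (L2 (MM (deriv a) v))
      - (starRingEnd ℂ) (inner ℂ (L2 (DD v)) (L2 (MM a v))) := by
    rw [inner_conj_symm]
    rw [L2_ibp v (MM a v), DD_MM ha, map_add, inner_add_right, ← L2_MM_symm ha]
    ring
  have h2 := congrArg Complex.re h1
  simp only [Complex.sub_re, Complex.neg_re, Complex.conj_re] at h2
  have h3 : 2 * (inner ℂ (L2 (DD v)) (L2 (MM a v))).re
      = -(inner ℂ (L2 v) (L2 (MM (deriv a) v))).re := by linarith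
  rw [h3, abs_neg]
  exact (Complex.abs_re_le_norm _).trans (norm_inner_le_norm _ _)

theorem im_DDDD_MM {a : ℝ → ℝ} (ha : a.HasTemperateGrowth) (v : SchwartzMap ℝ ℂ) :
    |(inner ℂ (L2 (DD (DD v))) (L2 (MM a v))).im| ≤ ‖L2 (DD v)‖ * ‖L2 (MM (deriv a) v)‖ := by
  have h1 : inner ℂ (L2 (DD (DD v))) (L2 (MM a v)) = - inner ℂ (L2 (DD v)) (L2 (MM (deriv a) v))
      - inner ℂ (L2 (DD v)) (L2 (MM a (DD v))) := by
    rw [L2_ibp, DD_MM ha, map_add, inner_add_right]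
    ring
  have h0 : (inner ℂ (L2 (DD v)) (L2 (MM a (DD v)))).im = 0 := by
    apply Complex.conj_eq_iff_im.1
    rw [inner_conj_symm, L2_MM_symm ha]
  have h2 := congrArg Complex.im h1
  simp only [Complex.sub_im, Complex.neg_im, h0, sub_zero] at h2
  rw [h2, abs_neg]
  exact (Complex.abs_im_le_norm _).trans (norm_inner_le_norm _ _)

theorem MM_rel {a r : ℝ → ℝ} (ha : a.HasTemperateGrowth) (hr : r.HasTemperateGrowth)
    (ha0 : ∀ x, 0 ≤ a x) (C : ℝ) (hC : 0 ≤ C) (h : ∀ x, |r x| ≤ C * (1 + a x))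
    (v : SchwartzMap ℝ ℂ) : ‖L2 (MM r v)‖ ≤ C * (‖L2 v‖ + ‖L2 (MM a v)‖) := by
  have h1 : ‖L2 (MM r v)‖ ≤ ‖L2 ((C : ℂ) • (v + MM a v))‖ := by
    apply L2_mono
    intro x
    rw [smul_apply, add_apply, MM_apply ha, MM_apply hr]
    have e : (C : ℂ) • (v x + (a x : ℂ) * v x) = ((C * (1 + a x) : ℝ) : ℂ) * v x := by
      simp only [smul_eq_mul]; push_cast; ring
    rw [e, norm_mul, norm_mul, Complex.norm_real, Complex.norm_real, Real.norm_eq_abs,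
      Real.norm_of_nonneg (by have := ha0 x; positivity)]
    exact mul_le_mul_of_nonneg_right (h x) (norm_nonneg _)
  refine h1.trans ?_
  rw [map_smul, norm_smul, Complex.norm_real, Real.norm_of_nonneg hC, map_add]
  exact mul_le_mul_of_nonneg_left (norm_add_le _ _) hC

/-- Graph norm estimate for `τ D + a - c`. -/
theorem graph_h {a : ℝ → ℝ} (ha : a.HasTemperateGrowth) (ha0 : ∀ x, 0 ≤ a x) (k c : ℝ)
    (hk : 1 ≤ k) (hda : ∀ x, |deriv a x| ≤ k * (1 + a x)) (hc0 : 0 ≤ c) (hck : c ≤ k)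
    (τ : ℝ) (hτ : τ = 1 ∨ τ = -1) (h : SchwartzMap ℝ ℂ) :
    ‖L2 (DD h)‖ ≤ 2 * k * (‖L2 ((τ : ℂ) • DD h + MM a h - (c : ℂ) • h)‖ + ‖L2 h‖) := by
  have hτa : |τ| = 1 := by rcases hτ with rfl | rfl <;> norm_num
  set g := (τ : ℂ) • DD h + MM a h - (c : ℂ) • h with hg
  have e : (τ : ℂ) • L2 (DD h) + L2 (MM a h) = L2 g + (c : ℂ) • L2 h := by
    rw [hg, map_sub, map_add, map_smul, map_smul, sub_add_cancel]
  have h1 : ‖(τ : ℂ) • L2 (DD h) + L2 (MM a h)‖ ≤ ‖L2 g‖ + c * ‖L2 h‖ := by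
    rw [e]
    refine (norm_add_le _ _).trans ?_
    rw [norm_smul, Complex.norm_real, Real.norm_of_nonneg hc0]
  have h2 := norm_add_sq (𝕜 := ℂ) ((τ : ℂ) • L2 (DD h)) (L2 (MM a h))
  rw [inner_smul_left, Complex.conj_ofReal, norm_smul, Complex.norm_real, Real.norm_eq_abs, hτa,
    one_mul] at h2
  have h3 : RCLike.re ((τ : ℂ) * inner ℂ (L2 (DD h)) (L2 (MM a h)))
      = τ * (inner ℂ (L2 (DD h)) (L2 (MM a h))).re := by
    simp
  rw [h3] at h2
  have h4 := re_DD_MM ha h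
  have h5 := MM_rel ha (temperate_deriv ha) ha0 k (by linarith) hda h
  have h6 : -(2 * (τ * (inner ℂ (L2 (DD h)) (L2 (MM a h))).re))
      ≤ ‖L2 h‖ * ‖L2 (MM (deriv a) h)‖ := by
    refine (neg_le_abs _).trans ?_
    rw [mul_left_comm, abs_mul, hτa, one_mul]; exact h4
  set X := ‖L2 (DD h)‖
  set A := ‖L2 (MM a h)‖
  set H := ‖L2 h‖
  set G := ‖L2 g‖
  set A' := ‖L2 (MM (deriv a) h)‖
  have hX : 0 ≤ X := norm_nonneg _
  have hA : 0 ≤ A := norm_nonneg _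
  have hH : 0 ≤ H := norm_nonneg _
  have hG : 0 ≤ G := norm_nonneg _
  have h7 : X ^ 2 + A ^ 2 ≤ (G + c * H) ^ 2 + H * (k * (H + A)) := by
    have t1 : H * A' ≤ H * (k * (H + A)) := mul_le_mul_of_nonneg_left h5 hH
    have t2 := pow_le_pow_left₀ (norm_nonneg _) h1 2
    linarith
  have h8 : G + c * H ≤ k * (G + H) := by nlinarith
  have h9 : (G + c * H) ^ 2 ≤ (k * (G + H)) ^ 2 := pow_le_pow_left₀ (by positivity) h8 2
  have h10 : H * (k * (H + A)) ≤ (k * (G + H)) * (k * (G + H) + A) := by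
    have s1 : H ≤ k * (G + H) := by nlinarith
    have s2 : k * (H + A) * H ≤ k * (G + H) * (k * (G + H) + A) := by
      have : H * (H + A) ≤ (G + H) * (k * (G + H) + A) :=
        mul_le_mul (by linarith) (by linarith) (by positivity) (by positivity)
      nlinarith
    linarith
  have h11 : X ^ 2 ≤ (2 * k * (G + H)) ^ 2 := by
    nlinarith [sq_nonneg (A - k * (G + H)), sq_nonneg (k * (G + H)), sq_nonneg A]
  exact le_of_sq_le_sq h11 (by positivity)

theorem kappa_norm (b : ℝ) (hb : 0 < b) : ‖(2 * Complex.I * (b : ℂ))⁻¹‖ = 1 / (2 * b) := by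
  rw [norm_inv, norm_mul, norm_mul, Complex.norm_I, Complex.norm_real, Real.norm_of_nonneg hb.le]
  norm_num

theorem kappa_conj (b : ℝ) : (starRingEnd ℂ) ((2 * Complex.I * (b : ℂ))⁻¹)
    = Complex.I * ((1 / (2 * b) : ℝ) : ℂ) := by
  rw [map_inv₀, map_mul, map_mul, Complex.conj_I, Complex.conj_ofReal]
  have : (starRingEnd ℂ) (2 : ℂ) = 2 := Complex.conj_ofNat 2
  rw [this]
  push_cast
  rw [mul_inv, mul_inv, inv_neg, Complex.inv_I, one_div, mul_inv]
  ring

/-- The zeroth order remainder `q - 2 c a + c²`. -/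
noncomputable def RR (a q : ℝ → ℝ) (c : ℝ) (v : SchwartzMap ℝ ℂ) : SchwartzMap ℝ ℂ :=
  MM q v - (2 * c : ℂ) • MM a v + ((c : ℂ) ^ 2) • v

/-- The conjugated operator. -/
noncomputable def PP (a q : ℝ → ℝ) (c b σ : ℝ) (v : SchwartzMap ℝ ℂ) : SchwartzMap ℝ ℂ :=
  -((σ : ℂ) • DD v) - (2 * Complex.I * (b : ℂ))⁻¹ • DD (DD v) + MM a v - (c : ℂ) • v
    + (2 * Complex.I * (b : ℂ))⁻¹ • RR a q c v

theorem RR_norm {a q : ℝ → ℝ} (ha : a.HasTemperateGrowth) (hq : q.HasTemperateGrowth)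
    (ha0 : ∀ x, 0 ≤ a x) (k C2 c0 c : ℝ) (hC2 : 0 ≤ C2) (hqa : ∀ x, |q x| ≤ C2 * (1 + a x))
    (hc0 : 0 ≤ c) (hc : c ≤ c0) (hk : C2 + 2 * c0 + c0 ^ 2 ≤ k) (v : SchwartzMap ℝ ℂ) :
    ‖L2 (RR a q c v)‖ ≤ k * (‖L2 v‖ + ‖L2 (MM a v)‖) := by
  have h1 := MM_rel ha hq ha0 C2 hC2 hqa v
  have h2 : ‖L2 (RR a q c v)‖ ≤ ‖L2 (MM q v)‖ + 2 * c * ‖L2 (MM a v)‖ + c ^ 2 * ‖L2 v‖ := by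
    rw [RR, map_add, map_sub, map_smul, map_smul]
    refine (norm_add_le _ _).trans (add_le_add ((norm_sub_le _ _).trans (add_le_add le_rfl ?_)) ?_)
    · rw [norm_smul, norm_mul, Complex.norm_real, Real.norm_of_nonneg hc0]; norm_num
    · rw [norm_smul, norm_pow, Complex.norm_real, Real.norm_of_nonneg hc0]
  have hV : 0 ≤ ‖L2 v‖ := norm_nonneg _
  have hA : 0 ≤ ‖L2 (MM a v)‖ := norm_nonneg _
  have hcc : c ^ 2 ≤ c0 ^ 2 := pow_le_pow_left₀ hc0 hc 2
  have h3 : c ^ 2 * ‖L2 v‖ ≤ c0 ^ 2 * ‖L2 v‖ := mul_le_mul_of_nonneg_right hcc hV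
  have h4 : 2 * c * ‖L2 (MM a v)‖ ≤ 2 * c0 * ‖L2 (MM a v)‖ :=
    mul_le_mul_of_nonneg_right (by linarith) hA
  have h5 := mul_le_mul_of_nonneg_right hk (add_nonneg hV hA)
  have h6 : 0 ≤ c0 * ‖L2 v‖ := mul_nonneg (hc0.trans hc) hV
  have h7 : 0 ≤ c0 ^ 2 * ‖L2 (MM a v)‖ := by positivity
  nlinarith

theorem graph_arith (Y A V F X R Z k b c I1 I2 : ℝ) (hY : 0 ≤ Y) (hA : 0 ≤ A) (hV : 0 ≤ V)
    (hF : 0 ≤ F) (hk : 1 ≤ k) (hb : 8 * k ≤ b) (hck : c ≤ k) (hX : X ≤ 2 * Y)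
    (hX0 : 0 ≤ X) (hZ0 : 0 ≤ Z)
    (hR : R ≤ k * (V + A)) (hZ : Z ≤ F + c * V + 1 / (2 * b) * R)
    (hI1 : |I1| ≤ V * (k * (V + A))) (hI2 : |I2| ≤ X * (k * (V + A)))
    (hE : Z ^ 2 = Y ^ 2 + A ^ 2 + I1 + I2 / b) :
    X ≤ 6 * k * (F + V) ∧ A ≤ 3 * k * (F + V) := by
  have hb0 : 0 < b := by linarith
  have hVA : 0 ≤ V + A := by positivity
  have hkb : k / b ≤ 1 / 8 := by rw [div_le_div_iff₀ hb0 (by norm_num)]; linarith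
  have z1 : 1 / (2 * b) * R ≤ (V + A) / 16 := by
    have : 1 / (2 * b) * R ≤ 1 / (2 * b) * (k * (V + A)) :=
      mul_le_mul_of_nonneg_left hR (by positivity)
    have e : 1 / (2 * b) * (k * (V + A)) = (k / b) * (V + A) / 2 := by field_simp
    have := mul_le_mul_of_nonneg_right hkb hVA
    linarith
  have z2 : c * V ≤ k * V := mul_le_mul_of_nonneg_right hck hV
  have z3 : F ≤ k * F := by nlinarith
  have hS : F + V ≤ k * (F + V) := by nlinarith
  set T := k * (F + V) with hT
  have hT0 : 0 ≤ T := by positivity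
  have z4 : Z ≤ 17 / 16 * T + A / 16 := by
    have : T = k * F + k * V := by rw [hT]; ring
    linarith
  have z5 : Z ^ 2 ≤ (17 / 16 * T + A / 16) ^ 2 := pow_le_pow_left₀ hZ0 z4 2
  have i1 : V * (k * (V + A)) ≤ T * (T + A) := by
    have e : V * (k * (V + A)) = (k * V) * (V + A) := by ring
    rw [e]
    have : k * V ≤ T := by rw [hT]; nlinarith
    exact mul_le_mul this (by linarith) hVA hT0
  have i2 : -(I2 / b) ≤ Y * (T + A) / 4 := by
    have s1 : -(I2 / b) ≤ X * (k * (V + A)) / b := by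
      rw [← neg_div]
      exact div_le_div_of_nonneg_right ((neg_le_abs _).trans hI2) hb0.le
    have e : X * (k * (V + A)) / b = (k / b) * (X * (V + A)) := by ring
    have s2 : X * (V + A) ≤ 2 * Y * (T + A) :=
      mul_le_mul hX (by linarith) hVA (by positivity)
    have s3 : (k / b) * (X * (V + A)) ≤ 1 / 8 * (2 * Y * (T + A)) :=
      mul_le_mul hkb s2 (by positivity) (by norm_num)
    linarith
  have i3 := neg_le_abs I1
  have main : Y ^ 2 + A ^ 2 ≤ (17 / 16 * T + A / 16) ^ 2 + T * (T + A) + Y * (T + A) / 4 := by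
    linarith
  have m2 : Y ^ 2 ≤ (3 * T) ^ 2 := by
    nlinarith [sq_nonneg (T - A), sq_nonneg (2 * T - A), sq_nonneg (2 * Y - (T + A)), sq_nonneg (Y - T),
      sq_nonneg A, sq_nonneg T]
  have m3 : A ^ 2 ≤ (3 * T) ^ 2 := by
    nlinarith [sq_nonneg (T - A), sq_nonneg (2 * T - A), sq_nonneg (2 * Y - (T + A)), sq_nonneg (Y - T),
      sq_nonneg A, sq_nonneg T]
  have y3 := le_of_sq_le_sq m2 (by positivity)
  have a3 := le_of_sq_le_sq m3 (by positivity)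
  constructor
  · rw [mul_assoc, ← hT]; linarith
  · rw [mul_assoc, ← hT]; linarith

theorem graph_v {a q : ℝ → ℝ} (ha : a.HasTemperateGrowth)
    (ha0 : ∀ x, 0 ≤ a x) (k c b σ : ℝ) (hk : 1 ≤ k)
    (hda : ∀ x, |deriv a x| ≤ k * (1 + a x)) (hc0 : 0 ≤ c) (hck : c ≤ k) (hb : 8 * k ≤ b)
    (hσ : σ = 1 ∨ σ = -1) (v : SchwartzMap ℝ ℂ)
    (hR : ‖L2 (RR a q c v)‖ ≤ k * (‖L2 v‖ + ‖L2 (MM a v)‖))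
    (hX : ‖L2 (DD v)‖ ≤ 2 * ‖L2 ((σ : ℂ) • DD v + (2 * Complex.I * (b : ℂ))⁻¹ • DD (DD v))‖) :
    ‖L2 (DD v)‖ ≤ 6 * k * (‖L2 (PP a q c b σ v)‖ + ‖L2 v‖) ∧
    ‖L2 (MM a v)‖ ≤ 3 * k * (‖L2 (PP a q c b σ v)‖ + ‖L2 v‖) := by
  have hb0 : 0 < b := by linarith
  have hσa : |σ| = 1 := by rcases hσ with rfl | rfl <;> norm_num
  set κ : ℂ := (2 * Complex.I * (b : ℂ))⁻¹ with hκ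
  have hκn : ‖κ‖ = 1 / (2 * b) := kappa_norm b hb0
  have hκc : (starRingEnd ℂ) κ = Complex.I * ((1 / (2 * b) : ℝ) : ℂ) := kappa_conj b
  set y : SchwartzMap ℝ ℂ := (σ : ℂ) • DD v + κ • DD (DD v) with hy
  have e : L2 (-y) + L2 (MM a v) = L2 (PP a q c b σ v) + (c : ℂ) • L2 v - κ • L2 (RR a q c v) := by
    rw [PP, hy, ← hκ]
    simp only [map_add, map_sub, map_neg, map_smul]
    abel
  have h1 : ‖L2 (-y) + L2 (MM a v)‖ ≤ ‖L2 (PP a q c b σ v)‖ + c * ‖L2 v‖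
      + 1 / (2 * b) * ‖L2 (RR a q c v)‖ := by
    rw [e]
    refine (norm_sub_le _ _).trans (add_le_add ((norm_add_le _ _).trans (add_le_add le_rfl ?_)) ?_)
    · rw [norm_smul, Complex.norm_real, Real.norm_of_nonneg hc0]
    · rw [norm_smul, hκn]
  have h2 := norm_add_sq (𝕜 := ℂ) (L2 (-y)) (L2 (MM a v))
  have h3 : 2 * RCLike.re (inner ℂ (L2 (-y)) (L2 (MM a v)))
      = -(σ * (2 * (inner ℂ (L2 (DD v)) (L2 (MM a v))).re))
        + (inner ℂ (L2 (DD (DD v))) (L2 (MM a v))).im / b := by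
    rw [map_neg, inner_neg_left, hy, map_add, map_smul, map_smul, inner_add_left, inner_smul_left,
      inner_smul_left, hκc, Complex.conj_ofReal]
    simp only [RCLike.re_to_complex, Complex.neg_re, Complex.add_re, Complex.mul_re,
      Complex.ofReal_re, Complex.ofReal_im, Complex.I_re, Complex.I_im, Complex.mul_im]
    field_simp
    ring
  have h5 := MM_rel ha (temperate_deriv ha) ha0 k (by linarith) hda v
  have h4 := re_DD_MM ha v
  have h6 := im_DDDD_MM ha v
  have hyn : ‖L2 (-y)‖ = ‖L2 y‖ := by rw [map_neg, norm_neg]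
  rw [h3, hyn] at h2
  refine graph_arith ‖L2 y‖ _ _ _ _ _ _ k b c
    (-(σ * (2 * (inner ℂ (L2 (DD v)) (L2 (MM a v))).re)))
    ((inner ℂ (L2 (DD (DD v))) (L2 (MM a v))).im) (norm_nonneg _) (norm_nonneg _) (norm_nonneg _)
    (norm_nonneg _) hk hb hck hX (norm_nonneg _) (norm_nonneg _) hR h1
    ?_ ?_ ?_
  · rw [abs_neg, abs_mul, hσa, one_mul]
    exact h4.trans (mul_le_mul_of_nonneg_left h5 (norm_nonneg _))
  · exact h6.trans (mul_le_mul_of_nonneg_left h5 (norm_nonneg _))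
  · rw [h2]; ring

theorem final_v {a q : ℝ → ℝ} (ha : a.HasTemperateGrowth)
    (ha0 : ∀ x, 0 ≤ a x) (k c b σ β N : ℝ) (hk : 1 ≤ k)
    (hda : ∀ x, |deriv a x| ≤ k * (1 + a x)) (hc0 : 0 ≤ c) (hck : c ≤ k) (hb : 8 * k ≤ b)
    (hσ : σ = 1 ∨ σ = -1) (v : SchwartzMap ℝ ℂ)
    (hR : ‖L2 (RR a q c v)‖ ≤ k * (‖L2 v‖ + ‖L2 (MM a v)‖))
    (hX : ‖L2 (DD v)‖ ≤ 2 * ‖L2 ((σ : ℂ) • DD v + (2 * Complex.I * (b : ℂ))⁻¹ • DD (DD v))‖)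
    (hβ0 : 0 ≤ β) (hβ : ∀ x, 1 ≤ (a x - c) + β / (1 + x ^ 2)) (M : ℝ)
    (hNM : N ≤ M)
    (hN : ∀ h : SchwartzMap ℝ ℂ, ‖L2 h‖ ≤ N * ‖L2 ((σ : ℂ) • DD h + MM a h - (c : ℂ) • h)‖) :
    ‖L2 v‖ ^ 2 ≤ ‖L2 v‖ * (N * ‖L2 (PP a q c b σ v)‖
      + 8 * k ^ 2 * (1 + M) / b * (‖L2 (PP a q c b σ v)‖ + ‖L2 v‖)) := by
  have hb0 : 0 < b := by linarith
  have hac : (fun x => a x - c).HasTemperateGrowth :=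
    ha.sub (Function.HasTemperateGrowth.const c)
  obtain ⟨hX6, hA3⟩ := graph_v ha ha0 k c b σ hk hda hc0 hck hb hσ v hR hX
  obtain ⟨h, hh⟩ := exists_sol_sign (fun x => a x - c) hac β hβ0 hβ σ hσ v
  have hv : (σ : ℂ) • DD h + MM a h - (c : ℂ) • h = v := by
    ext x
    rw [sub_apply, add_apply, smul_apply, smul_apply, MM_apply ha, DD_apply, ← hh x]
    simp only [smul_eq_mul]; push_cast; ring
  have h1 := hN h
  have h2 := graph_h ha ha0 k c hk hda hc0 hck σ hσ h
  have h3 := adj_identity ha c σ v h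
  rw [hv] at h1 h2 h3
  set κ : ℂ := (2 * Complex.I * (b : ℂ))⁻¹ with hκ
  have hκn : ‖κ‖ = 1 / (2 * b) := kappa_norm b hb0
  have e : L2 (-((σ : ℂ) • DD v) + MM a v - (c : ℂ) • v)
      = L2 (PP a q c b σ v) + κ • L2 (DD (DD v)) - κ • L2 (RR a q c v) := by
    rw [PP, ← hκ]
    simp only [map_add, map_sub, map_neg, map_smul]
    abel
  rw [e, inner_sub_left, inner_add_left, inner_smul_left, inner_smul_left, L2_ibp] at h3
  have h4 : ‖L2 v‖ ^ 2 ≤ ‖L2 (PP a q c b σ v)‖ * ‖L2 h‖ + 1 / (2 * b) * (‖L2 (DD v)‖ * ‖L2 (DD h)‖)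
      + 1 / (2 * b) * (‖L2 (RR a q c v)‖ * ‖L2 h‖) := by
    have s : ‖L2 v‖ ^ 2 = ‖inner ℂ (L2 v) (L2 v)‖ := by
      rw [inner_self_eq_norm_sq_to_K, norm_pow]; simp
    rw [s, h3]
    refine (norm_sub_le _ _).trans (add_le_add ((norm_add_le _ _).trans (add_le_add
      (norm_inner_le_norm _ _) ?_)) ?_)
    · rw [norm_mul, RCLike.norm_conj, hκn, norm_neg]
      exact mul_le_mul_of_nonneg_left (norm_inner_le_norm _ _) (by positivity)
    · rw [norm_mul, RCLike.norm_conj, hκn]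
      exact mul_le_mul_of_nonneg_left (norm_inner_le_norm _ _) (by positivity)
  set V := ‖L2 v‖
  set H := ‖L2 h‖
  set F := ‖L2 (PP a q c b σ v)‖
  set X := ‖L2 (DD v)‖
  set XH := ‖L2 (DD h)‖
  set R := ‖L2 (RR a q c v)‖
  set A := ‖L2 (MM a v)‖
  have hV : 0 ≤ V := norm_nonneg _
  have hH : 0 ≤ H := norm_nonneg _
  have hF : 0 ≤ F := norm_nonneg _
  have hX0 : 0 ≤ X := norm_nonneg _
  have hXH0 : 0 ≤ XH := norm_nonneg _
  have hR0 : 0 ≤ R := norm_nonneg _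
  have hHM : H ≤ M * V := h1.trans (mul_le_mul_of_nonneg_right hNM hV)
  have g1 : F * H ≤ F * (N * V) := mul_le_mul_of_nonneg_left h1 hF
  have g2 : XH ≤ 2 * k * (V + M * V) := h2.trans (by gcongr)
  have g3 : X * XH ≤ 6 * k * (F + V) * (2 * k * (V + M * V)) :=
    mul_le_mul hX6 g2 hXH0 (by positivity)
  have g4 : R ≤ 4 * k ^ 2 * (F + V) := by
    have : k * (V + A) ≤ k * (k * (F + V) + 3 * k * (F + V)) := by
      gcongr; nlinarith
    nlinarith
  have g5 : R * H ≤ 4 * k ^ 2 * (F + V) * (M * V) := mul_le_mul g4 hHM hH (by positivity)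
  have g6 : X * XH + R * H ≤ 16 * k ^ 2 * (1 + M) * (F + V) * V := by
    have : 0 ≤ k ^ 2 * (F + V) * V := by positivity
    nlinarith
  have g7 : 1 / (2 * b) * (X * XH + R * H) ≤ 1 / (2 * b) * (16 * k ^ 2 * (1 + M) * (F + V) * V) :=
    mul_le_mul_of_nonneg_left g6 (by positivity)
  have g8 : 1 / (2 * b) * (16 * k ^ 2 * (1 + M) * (F + V) * V)
      = V * (8 * k ^ 2 * (1 + M) / b * (F + V)) := by field_simp; ring
  have g9 : V ^ 2 ≤ F * (N * V) + V * (8 * k ^ 2 * (1 + M) / b * (F + V)) := by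
    rw [← g8]; linarith
  linarith

theorem final_arith (V F N n0 b D : ℝ) (hV : 0 ≤ V) (hF : 0 ≤ F) (hn0 : 0 < n0)
    (hN : n0 ≤ N) (hb : 0 < b) (hD : 0 ≤ D)
    (h : V ^ 2 ≤ V * (N * F + D / b * (F + V))) :
    (2 * b - (2 * D + 2 * D / n0 + 1)) * V ≤ N * (2 * b * F) := by
  have hN0 : 0 < N := hn0.trans_le hN
  have hR : 0 ≤ N * (2 * b * F) := by positivity
  rcases hV.eq_or_lt with h0 | hVp
  · rw [← h0, mul_zero]; exact hR
  have h1 : V ≤ N * F + D / b * (F + V) := by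
    rw [pow_two] at h; exact le_of_mul_le_mul_left h hVp
  rcases le_or_gt (2 * b - (2 * D + 2 * D / n0 + 1)) 0 with h2 | h2
  · exact (mul_nonpos_of_nonpos_of_nonneg h2 hV).trans hR
  set ε := D / b with hε
  set E := D / n0 / b with hE
  have hε0 : 0 ≤ ε := by positivity
  have hE0 : 0 ≤ E := by positivity
  have e1 : D / b * F ≤ E * (N * F) := by
    have : E * (N * F) = D / b * F * (N / n0) := by rw [hE]; field_simp
    rw [this]
    refine le_mul_of_one_le_right (by positivity) ?_
    rwa [one_le_div hn0]
  have e2 : (1 - ε) * V ≤ (1 + E) * (N * F) := by rw [← hε] at e1; linarith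
  have e3 : (1 - ε - E) * V * (1 + E) ≤ (N * F) * (1 + E) := by
    have : (1 - ε - E) * (1 + E) ≤ 1 - ε := by nlinarith [mul_nonneg hε0 hE0, sq_nonneg E]
    have := mul_le_mul_of_nonneg_right this hV
    linarith
  have e4 : (1 - ε - E) * V ≤ N * F := le_of_mul_le_mul_right e3 (by positivity)
  have e5 : 2 * b * (1 - ε - E) = 2 * b - (2 * D + 2 * D / n0) := by
    rw [hε, hE]; field_simp; ring
  have e6 := mul_le_mul_of_nonneg_left e4 (by positivity : 0 ≤ 2 * b)
  have e7 : (2 * b - (2 * D + 2 * D / n0)) * V ≤ 2 * b * (N * F) := by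
    rw [← e5]; linarith
  linarith

/-- Modulation by a character. -/
noncomputable def Modul (s : ℝ) (u : SchwartzMap ℝ ℂ) : SchwartzMap ℝ ℂ :=
  SchwartzMap.smulLeftCLM ℂ (fun x : ℝ => Complex.exp (Complex.I * s * x)) u

theorem Modul_apply (s : ℝ) (u : SchwartzMap ℝ ℂ) (x : ℝ) :
    Modul s u x = Complex.exp (Complex.I * s * x) * u x := by
  rw [Modul, SchwartzMap.smulLeftCLM_apply_apply (temperate_exp s), smul_eq_mul]

theorem DD_Modul (s : ℝ) (u : SchwartzMap ℝ ℂ) :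
    DD (Modul s u) = Modul s (DD u + (Complex.I * s) • u) := by
  ext x
  rw [DD_apply, Modul_apply, add_apply, smul_apply, DD_apply]
  have e : ⇑(Modul s u) = fun x : ℝ => Complex.exp (Complex.I * s * x) * u x := funext (Modul_apply s u)
  rw [e]
  have h1 : HasDerivAt (fun x : ℝ => Complex.I * s * (x : ℂ)) (Complex.I * s * 1) x :=
    (Complex.ofRealCLM.hasDerivAt).const_mul _
  refine (h1.cexp.mul (u.hasDerivAt x)).deriv.trans ?_
  rw [smul_eq_mul]
  ring

theorem Modul_norm_apply (s : ℝ) (u : SchwartzMap ℝ ℂ) (x : ℝ) : ‖Modul s u x‖ = ‖u x‖ := by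
  rw [Modul_apply, norm_mul]
  have : Complex.I * s * x = ((s * x : ℝ) : ℂ) * Complex.I := by push_cast; ring
  rw [this, Complex.norm_exp_ofReal_mul_I, one_mul]

theorem Modul_norm (s : ℝ) (u : SchwartzMap ℝ ℂ) : ‖L2 (Modul s u)‖ = ‖L2 u‖ :=
  le_antisymm (L2_mono fun x => (Modul_norm_apply s u x).le)
    (L2_mono fun x => (Modul_norm_apply s u x).ge)

theorem Modul_add (s : ℝ) (u w : SchwartzMap ℝ ℂ) : Modul s (u + w) = Modul s u + Modul s w := map_add _ _ _

theorem Modul_smul (s : ℝ) (z : ℂ) (u : SchwartzMap ℝ ℂ) : Modul s (z • u) = z • Modul s u :=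
  map_smul _ _ _

theorem mod_X (b : ℝ) (hb : 0 < b) (σ : ℝ) (hσ : σ = 1 ∨ σ = -1) (u : SchwartzMap ℝ ℂ)
    (hu : ∀ ξ, FT u ξ ≠ 0 → 0 ≤ σ * ξ) :
    ‖L2 (DD (Modul (-(σ * b)) u))‖ ≤ 2 * ‖L2 ((σ : ℂ) • DD (Modul (-(σ * b)) u)
      + (2 * Complex.I * (b : ℂ))⁻¹ • DD (DD (Modul (-(σ * b)) u)))‖ := by
  have hσ2 : (σ : ℂ) * σ = 1 := by
    rcases hσ with rfl | rfl <;> norm_num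
  have hbc : (b : ℂ) ≠ 0 := by exact_mod_cast hb.ne'
  have h1 := plancherel_est b hb.le σ hσ u hu
  have e1 : DD (Modul (-(σ * b)) u) = Modul (-(σ * b)) (DD u - (Complex.I * σ * b) • u) := by
    rw [DD_Modul, sub_eq_add_neg, ← neg_smul]
    congr 3
    push_cast; ring
  have e2 : (σ : ℂ) • DD (Modul (-(σ * b)) u)
      + (2 * Complex.I * (b : ℂ))⁻¹ • DD (DD (Modul (-(σ * b)) u))
      = (2 * Complex.I * (b : ℂ))⁻¹ • Modul (-(σ * b)) (DD (DD u) + ((b : ℂ) ^ 2) • u) := by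
    rw [DD_Modul, DD_Modul, ← Modul_smul, ← Modul_smul, ← Modul_smul, ← Modul_add]
    congr 1
    simp only [map_add, map_smul, smul_add, smul_smul]
    ext x
    simp only [add_apply, smul_apply, smul_eq_mul]
    push_cast
    field_simp
    have hs : (σ : ℂ) ^ 2 = 1 := by rw [pow_two]; exact hσ2
    ring_nf
    simp only [Complex.I_sq, hs]
    ring
  rw [e2, map_smul, norm_smul, kappa_norm b hb, Modul_norm, e1, Modul_norm]
  rw [← mul_assoc]
  have : 2 * (1 / (2 * b)) = 1 / b := by field_simp
  rw [this, one_div, ← div_eq_inv_mul, le_div_iff₀ hb]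
  linarith

theorem mod_T {a q : ℝ → ℝ} (ha : a.HasTemperateGrowth) (hq : q.HasTemperateGrowth) (c b : ℝ)
    (hb : 0 < b) (σ : ℝ) (hσ : σ = 1 ∨ σ = -1) (u : SchwartzMap ℝ ℂ) :
    eLpNorm (Tq a q (-(c : ℂ) + Complex.I * (b : ℂ)) ⇑u) 2 volume
      = ENNReal.ofReal (2 * b * ‖L2 (PP a q c b σ (Modul (-(σ * b)) u))‖) := by
  have hσ2 : (σ : ℂ) ^ 2 = 1 := by
    rcases hσ with rfl | rfl <;> norm_num
  have hbc : (b : ℂ) ≠ 0 := by exact_mod_cast hb.ne'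
  have e0 : 2 * b * ‖L2 (PP a q c b σ (Modul (-(σ * b)) u))‖
      = ‖L2 ((2 * Complex.I * (b : ℂ)) • PP a q c b σ (Modul (-(σ * b)) u))‖ := by
    rw [map_smul, norm_smul, norm_mul, norm_mul, Complex.norm_I, Complex.norm_real,
      Real.norm_of_nonneg hb.le]
    norm_num
  rw [e0, ← eLpNorm_eq_L2]
  refine eLpNorm_congr_norm_ae (Eventually.of_forall fun x => ?_)
  set E := Complex.exp (Complex.I * ((-(σ * b) : ℝ) : ℂ) * x) with hE
  have hEn : ‖E‖ = 1 := by
    have : Complex.I * ((-(σ * b) : ℝ) : ℂ) * x = ((-(σ * b) * x : ℝ) : ℂ) * Complex.I := by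
      push_cast; ring
    rw [hE, this, Complex.norm_exp_ofReal_mul_I]
  have e1 : ((2 * Complex.I * (b : ℂ)) • PP a q c b σ (Modul (-(σ * b)) u)) x
      = E * Tq a q (-(c : ℂ) + Complex.I * (b : ℂ)) (⇑u) x := by
    have t2 : deriv (deriv ⇑u) x = DD (DD u) x := rfl
    rw [PP, RR, DD_Modul, DD_Modul, Tq, t2]
    simp only [add_apply, sub_apply, smul_apply, neg_apply, MM_apply ha, MM_apply hq, Modul_apply,
      smul_eq_mul, ← hE, map_add, map_smul]
    push_cast
    field_simp
    ring_nf
    simp only [Complex.I_sq, hσ2]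
    ring_nf
  rw [e1, norm_mul, hEn, one_mul]

theorem exists_schwartz_ne_zero : ∃ φ : SchwartzMap ℝ ℂ, φ ≠ 0 := by
  let f : ContDiffBump (0 : ℝ) := ⟨1, 2, by norm_num, by norm_num⟩
  have hc : HasCompactSupport (fun x => ((f x : ℝ) : ℂ)) :=
    f.hasCompactSupport.comp_left (g := fun y : ℝ => (y : ℂ)) (by simp)
  have hs : ContDiff ℝ ∞ (fun x => ((f x : ℝ) : ℂ)) :=
    Complex.ofRealCLM.contDiff.comp f.contDiff
  refine ⟨hc.toSchwartzMap hs, fun h => ?_⟩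
  have h1 : (hc.toSchwartzMap hs) 0 = 0 := by rw [h]; rfl
  have h2 : (hc.toSchwartzMap hs) 0 = ((f 0 : ℝ) : ℂ) := rfl
  have h3 : f 0 = 1 := f.one_of_mem_closedBall (by simp [f])
  rw [h2, h3] at h1
  simp at h1

theorem std_da {a q : ℝ → ℝ} (h : Standing a q) :
    ∃ C : ℝ, 0 < C ∧ ∀ x, |deriv a x| ≤ C * (1 + a x) := by
  obtain ⟨C, hC, h1⟩ := h.deriv_a 1 le_rfl
  refine ⟨C, hC, fun x => ?_⟩
  have h2 := h1 x
  rw [iteratedDeriv_one] at h2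
  refine h2.trans (mul_le_of_le_one_right (by have := h.nonneg_a x; positivity) ?_)
  refine Real.rpow_le_one_of_one_le_of_nonpos (by nlinarith [sq_nonneg x]) (by norm_num)

theorem std_q {a q : ℝ → ℝ} (h : Standing a q) :
    ∃ C : ℝ, 0 ≤ C ∧ ∀ x, |q x| ≤ C * (1 + a x) := by
  obtain ⟨K0, hK0, x0, hx0, h1⟩ := h.q_le_a
  obtain ⟨B, hB⟩ := (isCompact_Icc (a := -x0) (b := x0)).exists_bound_of_continuousOn
    (f := q) h.smooth_q.continuous.continuousOn
  refine ⟨K0 + |B|, by positivity, fun x => ?_⟩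
  have hx := h.nonneg_a x
  rw [abs_of_nonneg (h.nonneg_q x)]
  have t1 : 0 ≤ K0 * 1 := by positivity
  have t2 : 0 ≤ |B| * a x := by positivity
  have t3 : 0 ≤ K0 * a x := by positivity
  have t4 := abs_nonneg B
  rcases lt_or_ge x0 |x| with hh | hh
  · have := h1 x hh
    linarith
  · have := hB x (abs_le.1 hh)
    have s := le_abs_self B
    rw [Real.norm_of_nonneg (h.nonneg_q x)] at this
    linarith

theorem std_beta {a q : ℝ → ℝ} (h : Standing a q) (c0 : ℝ) (hc0 : 0 ≤ c0) :
    ∃ β : ℝ, 0 ≤ β ∧ ∀ c, c ≤ c0 → ∀ x, 1 ≤ (a x - c) + β / (1 + x ^ 2) := by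
  have h1 := h.unbounded_a.eventually_ge_atTop (1 + c0)
  rw [Filter.Eventually, Metric.cobounded_eq_cocompact.symm] at h1
  obtain ⟨R, hR⟩ := (Metric.isCobounded_iff_closedBall_compl_subset (0 : ℝ)).1 h1
  refine ⟨(1 + R ^ 2) * (1 + c0), by positivity, fun c hc x => ?_⟩
  have hx := h.nonneg_a x
  have hp : 0 < 1 + x ^ 2 := by positivity
  by_cases hxR : x ∈ Metric.closedBall (0 : ℝ) R
  · rw [mem_closedBall_zero_iff, Real.norm_eq_abs] at hxR
    have hs : x ^ 2 ≤ R ^ 2 := by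
      rw [← sq_abs x]; exact pow_le_pow_left₀ (abs_nonneg x) hxR 2
    have : 1 + c0 ≤ (1 + R ^ 2) * (1 + c0) / (1 + x ^ 2) := by
      rw [le_div_iff₀ hp, mul_comm]
      exact mul_le_mul_of_nonneg_right (by linarith) (by linarith)
    linarith
  · have h2 : 1 + c0 ≤ a x := hR hxR
    have : 0 ≤ (1 + R ^ 2) * (1 + c0) / (1 + x ^ 2) := by positivity
    linarith

theorem std_main {a q : ℝ → ℝ} (h : Standing a q) (c0 : ℝ) (hc0 : 0 ≤ c0) :
    ∃ C : ℝ, 0 < C ∧ ∃ b₀ : ℝ, 0 < b₀ ∧ ∀ c, 0 ≤ c → c ≤ c0 → ∀ b : ℝ, b₀ ≤ b →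
      ∀ σ : ℝ, (σ = 1 ∨ σ = -1) → ∀ u : SchwartzMap ℝ ℂ,
        (∀ ξ, FT u ξ ≠ 0 → 0 ≤ σ * ξ) →
          ENNReal.ofReal (2 * b - C) * eLpNorm (⇑u) 2 volume
            ≤ NA a c * eLpNorm (Tq a q (-(c : ℂ) + Complex.I * (b : ℂ)) ⇑u) 2 volume := by
  have ha : a.HasTemperateGrowth := temperate_of_std a h.smooth_a h.nonneg_a h.deriv_a
  have hq : q.HasTemperateGrowth := temperate_of_std q h.smooth_q h.nonneg_q h.deriv_q
  obtain ⟨C1, hC1, hda⟩ := std_da h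
  obtain ⟨C2, hC2, hqa⟩ := std_q h
  obtain ⟨β, hβ0, hβ⟩ := std_beta h c0 hc0
  obtain ⟨φ, hφ⟩ := exists_schwartz_ne_zero
  have hφ0 := L2_ne_zero hφ
  set M := Real.exp (Real.pi * β) with hM
  have hM0 : 0 < M := Real.exp_pos _
  set k := C1 + (C2 + 2 * c0 + c0 ^ 2) + 1 with hk
  have hk1 : 1 ≤ k := by rw [hk]; nlinarith [sq_nonneg c0]
  have hkc : c0 ≤ k := by rw [hk]; nlinarith [sq_nonneg c0]
  have hkC1 : C1 ≤ k := by rw [hk]; nlinarith [sq_nonneg c0]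
  have hkC2 : C2 + 2 * c0 + c0 ^ 2 ≤ k := by rw [hk]; linarith
  set G := ‖L2 (((1 : ℝ) : ℂ) • DD φ + MM a φ)‖ + c0 * ‖L2 φ‖ + 1 with hG
  have hG0 : 0 < G := by positivity
  set n0 := ‖L2 φ‖ / G with hn0
  have hn0p : 0 < n0 := by positivity
  set D := 8 * k ^ 2 * (1 + M) with hD
  have hD0 : 0 ≤ D := by positivity
  refine ⟨2 * D + 2 * D / n0 + 1, by positivity, 8 * k, by linarith, ?_⟩
  intro c hc hcc b hb σ hσ u hu
  have hb0 : 0 < b := by linarith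
  obtain ⟨N, hN0, hNM, hNA, hN⟩ := NA_facts a ha β c hβ0 (hβ c hcc)
  have hn : n0 ≤ N := by
    have h1 := hN 1 (Or.inl rfl) φ
    have h2 : ‖L2 (((1 : ℝ) : ℂ) • DD φ + MM a φ - (c : ℂ) • φ)‖ ≤ G := by
      rw [map_sub, map_smul]
      refine (norm_sub_le _ _).trans ?_
      rw [norm_smul, Complex.norm_real, Real.norm_of_nonneg hc, hG]
      have := mul_le_mul_of_nonneg_right hcc hφ0.le
      linarith
    rw [hn0, div_le_iff₀ hG0]
    exact h1.trans (mul_le_mul_of_nonneg_left h2 hN0)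
  set v := Modul (-(σ * b)) u with hv
  have hR := RR_norm ha hq h.nonneg_a k C2 c0 c hC2 hqa hc hcc hkC2 v
  have hda' : ∀ x, |deriv a x| ≤ k * (1 + a x) := fun x =>
    (hda x).trans (mul_le_mul_of_nonneg_right hkC1 (by linarith [h.nonneg_a x]))
  have hX := mod_X b hb0 σ hσ u hu
  have hfin := final_v ha h.nonneg_a k c b σ β N hk1 hda' hc (hcc.trans hkc) hb hσ v hR hX hβ0
    (hβ c hcc) M hNM (hN σ hσ)
  have hfin2 := final_arith ‖L2 v‖ ‖L2 (PP a q c b σ v)‖ N n0 b D (norm_nonneg _) (norm_nonneg _)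
    hn0p hn hb0 hD0 hfin
  rw [mod_T ha hq c b hb0 σ hσ u, hNA, eLpNorm_eq_L2, ← ENNReal.ofReal_mul hN0,
    ← ENNReal.ofReal_mul' (norm_nonneg _)]
  refine ENNReal.ofReal_le_ofReal ?_
  rw [hv, Modul_norm] at hfin2
  exact hfin2

theorem stmt7 (a q : ℝ → ℝ) (h : Standing a q)
    (K : Set ℝ) (hKb : Bornology.IsBounded K) (hK : K ⊆ Set.Ici 0) :
    ∃ δ : ℝ, δ ∈ Set.Ioo (0 : ℝ) (1 / 4) ∧
      ∃ C : ℝ, 0 < C ∧ ∃ b₀ : ℝ, 0 < b₀ ∧ ∀ c ∈ K, ∀ b : ℝ, b₀ ≤ b →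
        ∀ u : SchwartzMap ℝ ℂ,
          (Function.support (FT (⇑u)) ⊆ Set.Ioo (b - 2 * δ * b) (b + 2 * δ * b) ∨
            Function.support (FT (⇑u)) ⊆ Set.Ioo (-b - 2 * δ * b) (-b + 2 * δ * b)) →
          ENNReal.ofReal (2 * b - C) * eLpNorm (⇑u) 2 volume
            ≤ NA a c * eLpNorm (Tq a q (-(c : ℂ) + Complex.I * (b : ℂ)) ⇑u) 2 volume := by
  obtain ⟨R, hR⟩ := hKb.exists_norm_le
  obtain ⟨C, hC, b₀, hb₀, hmain⟩ := std_main h |R| (abs_nonneg R)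
  refine ⟨1 / 8, ⟨by norm_num, by norm_num⟩, C, hC, b₀, hb₀, ?_⟩
  intro c hc b hb u hu
  have hc1 : c ≤ |R| := (le_abs_self c).trans ((hR c hc).trans (le_abs_self R))
  have hb0 : 0 < b := by linarith
  rcases hu with hu | hu
  · refine hmain c (hK hc) hc1 b hb 1 (Or.inl rfl) u (fun ξ hξ => ?_)
    have := (hu (Function.mem_support.2 hξ)).1
    linarith
  · refine hmain c (hK hc) hc1 b hb (-1) (Or.inr rfl) u (fun ξ hξ => ?_)
    have := (hu (Function.mem_support.2 hξ)).2
    linarith
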